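/- Fix d > 1 and a finite alphabet X with |X| = d. Let V_d be the set of all bijections τ of X^ω for which there exist finite words v₁,…,v_m and u₁,…,u_m in X* such that every infinite word in X^ω has exactly one of the v_i as a prefix and exactly one of the u_j as a prefix, and τ(v_i w) = u_i w for all i and all w ∈ X^ω. Then V_d is a group under composition (the Higman–Thompson group); V_d is finitely presented; its commutator subgroup V_d′ = [V_d, V_d] equals V_d when d is even and has index 2 in V_d when d is odd; and V_d′ is simple and is the only non-trivial proper normal subgroup of V_d. -/

import Mathlib

/-- `v` is a prefix of the infinite word `w`. -/
def IsPrefix {X : Type*} (v : List X) (w : ℕ → X) : Prop :=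
  ∀ i : Fin v.length, w i = v.get i

/-- Concatenation of a finite word `v` with an infinite word `w`. -/
def appendInf {X : Type*} (v : List X) (w : ℕ → X) : ℕ → X :=
  fun n => if h : n < v.length then v.get ⟨n, h⟩ else w (n - v.length)

/-- A bijection `τ` of `X^ω` is a Higman–Thompson table map if there are finite words
`v₁,…,v_m` and `u₁,…,u_m` such that every infinite word has exactly one `v_i` and exactly
one `u_j` as a prefix, and `τ(v_i w) = u_i w` for all `i` and `w`. -/
def IsTableMap {X : Type*} (τ : Equiv.Perm (ℕ → X)) : Prop :=
  ∃ (m : ℕ) (v u : Fin m → List X),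
    (∀ w : ℕ → X, ∃! i : Fin m, IsPrefix (v i) w) ∧
    (∀ w : ℕ → X, ∃! i : Fin m, IsPrefix (u i) w) ∧
    (∀ (i : Fin m) (w : ℕ → X), τ (appendInf (v i) w) = appendInf (u i) w)

/-- A group is finitely presented if it is a quotient of a finitely generated free group
by the normal closure of a finite set of relators. -/
def IsFinitelyPresentedGroup (G : Type*) [Group G] : Prop :=
  ∃ (n : ℕ) (rels : Finset (FreeGroup (Fin n))),
    Nonempty (G ≃* FreeGroup (Fin n) ⧸ Subgroup.normalClosure (rels : Set (FreeGroup (Fin n))))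

namespace HigmanThompson

open Function

section Words

variable {X : Type*}

theorem appendInf_of_lt {v : List X} {n : ℕ} (h : n < v.length) (w : ℕ → X) :
    appendInf v w n = v[n] := by
  simp [appendInf, h]

theorem appendInf_add (v : List X) (w : ℕ → X) (n : ℕ) :
    appendInf v w (v.length + n) = w n := by
  simp [appendInf]

theorem appendInf_append (u v : List X) (w : ℕ → X) :
    appendInf (u ++ v) w = appendInf u (appendInf v w) := by
  ext n
  simp only [appendInf, List.length_append, List.get_eq_getElem, List.getElem_append]
  split_ifs <;> first | rfl | (exfalso; omega) | (congr 1; omega)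

theorem appendInf_right_injective (v : List X) : Injective (appendInf v) := fun w w' h => by
  ext n
  rw [← appendInf_add v w n, h, appendInf_add]

theorem isPrefix_iff {v : List X} {w : ℕ → X} :
    IsPrefix v w ↔ ∀ i (h : i < v.length), w i = v[i] :=
  ⟨fun h i hi => h ⟨i, hi⟩, fun h i => h i i.2⟩

theorem isPrefix_appendInf (v : List X) (w : ℕ → X) : IsPrefix v (appendInf v w) :=
  isPrefix_iff.2 fun _ hi => appendInf_of_lt hi w

theorem isPrefix_nil (w : ℕ → X) : IsPrefix [] w := isPrefix_iff.2 (by simp)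

theorem isPrefix_iff_exists {v : List X} {w : ℕ → X} :
    IsPrefix v w ↔ ∃ w', w = appendInf v w' := by
  refine ⟨fun h => ⟨fun n => w (v.length + n), ?_⟩, ?_⟩
  · ext n
    by_cases hn : n < v.length
    · rw [appendInf_of_lt hn, isPrefix_iff.1 h n hn]
    · simp only [appendInf, hn, dite_false]
      congr 1; omega
  · rintro ⟨w', rfl⟩
    exact isPrefix_appendInf v w'

theorem isPrefix_append_appendInf {u v : List X} {w : ℕ → X} :
    IsPrefix (u ++ v) (appendInf u w) ↔ IsPrefix v w := by
  simp only [isPrefix_iff_exists, appendInf_append, (appendInf_right_injective u).eq_iff]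

theorem _root_.IsPrefix.mono {u v : List X} {w : ℕ → X} (hv : IsPrefix v w) (h : u <+: v) :
    IsPrefix u w := by
  obtain ⟨t, rfl⟩ := h
  obtain ⟨w', rfl⟩ := isPrefix_iff_exists.1 hv
  rw [appendInf_append]
  exact isPrefix_appendInf _ _

theorem _root_.IsPrefix.prefix_of_length_le {u v : List X} {w : ℕ → X} (hu : IsPrefix u w)
    (hv : IsPrefix v w) (h : u.length ≤ v.length) : u <+: v := by
  rw [List.prefix_iff_eq_take]
  apply List.ext_getElem
  · simp [h]
  · intro n h1 h2
    rw [List.getElem_take, ← isPrefix_iff.1 hu, ← isPrefix_iff.1 hv]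

theorem _root_.IsPrefix.comparable {u v : List X} {w : ℕ → X} (hu : IsPrefix u w)
    (hv : IsPrefix v w) : u <+: v ∨ v <+: u :=
  (le_total u.length v.length).imp (hu.prefix_of_length_le hv) (hv.prefix_of_length_le hu)

theorem exists_isPrefix [Nonempty X] (v : List X) : ∃ w, IsPrefix v w :=
  ⟨_, isPrefix_appendInf v fun _ => Classical.arbitrary X⟩

theorem prefix_of_forall_isPrefix [Nontrivial X] {u v : List X}
    (h : ∀ w, IsPrefix u w → IsPrefix v w) : v <+: u := by
  obtain ⟨x, -, -⟩ := exists_pair_ne X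
  have h1 := h _ (isPrefix_appendInf u fun _ => x)
  by_cases hl : v.length ≤ u.length
  · exact h1.prefix_of_length_le (isPrefix_appendInf u _) hl
  · push Not at hl
    obtain ⟨y, hy⟩ := exists_ne v[u.length]
    have h2 := isPrefix_iff.1 (h _ (isPrefix_appendInf u fun _ => y)) _ hl
    exact absurd (h2.symm.trans (appendInf_add u _ 0)) hy.symm

end Words

/-- A complete prefix code indexed by `ι`: every infinite word has exactly one of the words as a
prefix. -/
structure PrefixBasis (X ι : Type*) where
  /-- The words of the code. -/
  word : ι → List X
  existsUnique_isPrefix : ∀ w : ℕ → X, ∃! i, IsPrefix (word i) w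

namespace PrefixBasis

variable {X ι κ : Type*}

instance : CoeFun (PrefixBasis X ι) fun _ => ι → List X := ⟨word⟩

@[ext]
theorem ext {b c : PrefixBasis X ι} (h : ∀ i, b i = c i) : b = c := by
  cases b; cases c; congr; exact funext h

theorem exists_isPrefix (b : PrefixBasis X ι) (w : ℕ → X) : ∃ i, IsPrefix (b i) w :=
  (b.existsUnique_isPrefix w).exists

theorem eq_of_isPrefix (b : PrefixBasis X ι) {w : ℕ → X} {i j : ι} (hi : IsPrefix (b i) w)
    (hj : IsPrefix (b j) w) : i = j :=
  (b.existsUnique_isPrefix w).unique hi hj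

theorem eq_of_prefix [Nonempty X] (b : PrefixBasis X ι) {i j : ι} (h : b i <+: b j) : i = j := by
  obtain ⟨w, hw⟩ := HigmanThompson.exists_isPrefix (b j)
  exact b.eq_of_isPrefix (hw.mono h) hw

theorem injective [Nonempty X] (b : PrefixBasis X ι) : Injective b := fun _ _ h =>
  b.eq_of_prefix (h ▸ List.prefix_refl _)

/-- Change of index type. -/
def reindex (b : PrefixBasis X ι) (e : κ ≃ ι) : PrefixBasis X κ where
  word := b ∘ e
  existsUnique_isPrefix w := by
    obtain ⟨i, hi, hu⟩ := b.existsUnique_isPrefix w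
    exact ⟨e.symm i, by simpa using hi, fun j hj => by rw [← hu _ hj]; simp⟩

@[simp]
theorem reindex_apply (b : PrefixBasis X ι) (e : κ ≃ ι) (k : κ) : b.reindex e k = b (e k) := rfl

/-- The one-element code consisting of the empty word. -/
def trivial : PrefixBasis X Unit where
  word _ := []
  existsUnique_isPrefix w := ⟨(), isPrefix_nil w, fun _ _ => rfl⟩

/-- The decomposition of the space of infinite words into cones. -/
noncomputable def equiv (b : PrefixBasis X ι) : ι × (ℕ → X) ≃ (ℕ → X) :=
  Equiv.ofBijective (fun p => appendInf (b p.1) p.2) <| by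
    constructor
    · rintro ⟨i, w⟩ ⟨j, w'⟩ h
      dsimp only at h
      obtain rfl : i = j := b.eq_of_isPrefix (isPrefix_appendInf _ w)
        (h ▸ isPrefix_appendInf _ w')
      rw [appendInf_right_injective _ h]
    · intro w
      obtain ⟨i, hi⟩ := b.exists_isPrefix w
      obtain ⟨w', rfl⟩ := isPrefix_iff_exists.1 hi
      exact ⟨(i, w'), rfl⟩

@[simp]
theorem equiv_apply (b : PrefixBasis X ι) (i : ι) (w : ℕ → X) :
    b.equiv (i, w) = appendInf (b i) w := rfl

@[simp]
theorem equiv_symm_appendInf (b : PrefixBasis X ι) (i : ι) (w : ℕ → X) :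
    b.equiv.symm (appendInf (b i) w) = (i, w) := by
  rw [← equiv_apply, Equiv.symm_apply_apply]

/-- The table map carrying the code `b` to the code `c`. -/
noncomputable def elt (b c : PrefixBasis X ι) : Equiv.Perm (ℕ → X) := b.equiv.symm.trans c.equiv

@[simp]
theorem elt_appendInf (b c : PrefixBasis X ι) (i : ι) (w : ℕ → X) :
    elt b c (appendInf (b i) w) = appendInf (c i) w := by
  simp [elt]

theorem eq_elt {b c : PrefixBasis X ι} {g : Equiv.Perm (ℕ → X)}
    (h : ∀ i w, g (appendInf (b i) w) = appendInf (c i) w) : g = elt b c := by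
  ext1 w
  obtain ⟨⟨i, w'⟩, rfl⟩ := b.equiv.surjective w
  simp [h]

@[simp]
theorem elt_mul_elt (b c e : PrefixBasis X ι) : elt c e * elt b c = elt b e :=
  eq_elt fun i w => by simp

@[simp]
theorem elt_self (b : PrefixBasis X ι) : elt b b = 1 := (eq_elt fun i w => by simp).symm

theorem elt_inv (b c : PrefixBasis X ι) : (elt b c)⁻¹ = elt c b := by
  rw [inv_eq_iff_mul_eq_one, elt_mul_elt, elt_self]

@[simp]
theorem elt_reindex (b c : PrefixBasis X ι) (e : κ ≃ ι) :
    elt (b.reindex e) (c.reindex e) = elt b c :=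
  (eq_elt fun i w => by simp).symm

/-- The image of a code under a bijection that acts on its cones by prefix replacement. -/
def map (b : PrefixBasis X ι) (g : Equiv.Perm (ℕ → X)) (c : ι → List X)
    (h : ∀ i w, g (appendInf (b i) w) = appendInf (c i) w) : PrefixBasis X ι where
  word := c
  existsUnique_isPrefix w := by
    have key : ∀ i, IsPrefix (c i) w ↔ IsPrefix (b i) (g.symm w) := fun i => by
      simp only [isPrefix_iff_exists, ← h, Equiv.symm_apply_eq]
    simpa only [key] using b.existsUnique_isPrefix (g.symm w)

theorem elt_map (b : PrefixBasis X ι) (g : Equiv.Perm (ℕ → X)) (c : ι → List X)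
    (h : ∀ i w, g (appendInf (b i) w) = appendInf (c i) w) : elt b (b.map g c h) = g :=
  (eq_elt h).symm

/-- Two codes have a common refinement. -/
theorem exists_common_refinement {ι κ : Type} (b : PrefixBasis X ι) (c : PrefixBasis X κ)
    [Finite ι] [Finite κ] :
    ∃ (l : Type) (_ : Fintype l) (r : PrefixBasis X l) (s : l → ι) (t : l → κ),
      (∀ k, b (s k) <+: r k) ∧ ∀ k, c (t k) <+: r k := by
  classical
  let l := {p : ι × κ // b p.1 <+: c p.2 ∨ c p.2 <+: b p.1}
  let f : l → List X := fun p => if b p.1.1 <+: c p.1.2 then c p.1.2 else b p.1.1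
  have hf1 : ∀ p : l, b p.1.1 <+: f p := fun p => by
    simp only [f]; split_ifs with h
    · exact h
    · exact List.prefix_refl _
  have hf2 : ∀ p : l, c p.1.2 <+: f p := fun p => by
    simp only [f]; split_ifs with h
    · exact List.prefix_refl _
    · exact p.2.resolve_left h
  refine ⟨l, Fintype.ofFinite _, ⟨f, fun w => ?_⟩, fun p => p.1.1, fun p => p.1.2, hf1, hf2⟩
  obtain ⟨i, hi⟩ := b.exists_isPrefix w
  obtain ⟨k, hk⟩ := c.exists_isPrefix w
  refine ⟨⟨(i, k), hi.comparable hk⟩, ?_, ?_⟩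
  · simp only [f]; split_ifs <;> assumption
  · rintro ⟨⟨i', k'⟩, h⟩ h'
    obtain rfl := b.eq_of_isPrefix hi (h'.mono (hf1 _))
    obtain rfl := c.eq_of_isPrefix hk (h'.mono (hf2 _))
    rfl

/-- A table map has a table on every refinement of its source code. -/
theorem exists_elt_eq_of_refinement (b c : PrefixBasis X ι) (r : PrefixBasis X κ) (s : κ → ι)
    (h : ∀ k, b (s k) <+: r k) :
    ∃ r' : PrefixBasis X κ, elt b c = elt r r' ∧ ∀ k, c (s k) <+: r' k := by
  choose t ht using h
  refine ⟨r.map (elt b c) (fun k => c (s k) ++ t k) fun k w => ?_, (elt_map _ _ _ _).symm,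
    fun k => List.prefix_append _ _⟩
  rw [← ht, appendInf_append, appendInf_append, elt_appendInf]

end PrefixBasis

theorem isTableMap_iff {X : Type*} {g : Equiv.Perm (ℕ → X)} :
    IsTableMap g ↔ ∃ (m : ℕ) (b c : PrefixBasis X (Fin m)), g = PrefixBasis.elt b c := by
  constructor
  · rintro ⟨m, v, u, hv, hu, h⟩
    exact ⟨m, ⟨v, hv⟩, ⟨u, hu⟩, PrefixBasis.eq_elt h⟩
  · rintro ⟨m, b, c, rfl⟩
    exact ⟨m, b, c, b.existsUnique_isPrefix, c.existsUnique_isPrefix,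
      fun i w => PrefixBasis.elt_appendInf b c i w⟩

theorem isTableMap_elt {X ι : Type*} [Finite ι] (b c : PrefixBasis X ι) :
    IsTableMap (PrefixBasis.elt b c) := by
  obtain ⟨n, ⟨e⟩⟩ := Finite.exists_equiv_fin ι
  exact isTableMap_iff.2 ⟨n, b.reindex e.symm, c.reindex e.symm, by simp⟩

/-- Two table maps can be composed along a common code. -/
theorem exists_elt_elt {X : Type*} {g h : Equiv.Perm (ℕ → X)} (hg : IsTableMap g)
    (hh : IsTableMap h) : ∃ (n : ℕ) (b c e : PrefixBasis X (Fin n)),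
      g = PrefixBasis.elt b c ∧ h = PrefixBasis.elt c e := by
  obtain ⟨m, b, c, rfl⟩ := isTableMap_iff.1 hg
  obtain ⟨k, b', c', rfl⟩ := isTableMap_iff.1 hh
  obtain ⟨l, _, r, s, t, hs, ht⟩ := c.exists_common_refinement b'
  obtain ⟨e, he, -⟩ := PrefixBasis.exists_elt_eq_of_refinement b' c' r t ht
  obtain ⟨a, ha, -⟩ := PrefixBasis.exists_elt_eq_of_refinement c b r s hs
  let f := (Fintype.equivFin l).symm
  refine ⟨_, a.reindex f, r.reindex f, e.reindex f, ?_, ?_⟩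
  · rw [PrefixBasis.elt_reindex, ← PrefixBasis.elt_inv r a, ← ha, PrefixBasis.elt_inv]
  · rw [PrefixBasis.elt_reindex, he]

/-- The Higman–Thompson group of table maps. -/
def tableGroup (X : Type*) : Subgroup (Equiv.Perm (ℕ → X)) where
  carrier := {g | IsTableMap g}
  one_mem' := by
    rw [Set.mem_ofPred_eq, ← PrefixBasis.elt_self PrefixBasis.trivial]
    exact isTableMap_elt _ _
  mul_mem' {g h} hg hh := by
    obtain ⟨n, b, c, e, rfl, rfl⟩ := exists_elt_elt hh hg
    rw [Set.mem_ofPred_eq, PrefixBasis.elt_mul_elt]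
    exact isTableMap_elt _ _
  inv_mem' {g} hg := by
    obtain ⟨m, b, c, rfl⟩ := isTableMap_iff.1 hg
    rw [Set.mem_ofPred_eq, PrefixBasis.elt_inv]
    exact isTableMap_elt _ _

theorem eq_of_appendInf_eq {X : Type*} [Nontrivial X] {u v : List X}
    (h : ∀ w : ℕ → X, appendInf u w = appendInf v w) : u = v := by
  have aux : ∀ {u v : List X}, (∀ w : ℕ → X, appendInf u w = appendInf v w) → v <+: u := by
    intro u v h
    refine prefix_of_forall_isPrefix fun w hw => ?_
    obtain ⟨w', rfl⟩ := isPrefix_iff_exists.1 hw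
    rw [h]
    exact isPrefix_appendInf _ _
  have h1 := aux h
  have h2 := aux fun w => (h w).symm
  exact h2.eq_of_length (le_antisymm h2.length_le h1.length_le)

/-- Two injective families of the same shape in finite types of the same cardinality correspond
under a bijection. -/
theorem exists_equiv_comp_eq {S ι κ : Type*} [Fintype ι] [Fintype κ]
    (h : Fintype.card ι = Fintype.card κ) {f : S → ι} {g : S → κ} (hf : Injective f)
    (hg : Injective g) : ∃ e : ι ≃ κ, ∀ s, e (f s) = g s := by
  classical
  rcases isEmpty_or_nonempty S with hS | hS
  · exact ⟨Fintype.equivOfCardEq h, fun s => hS.elim s⟩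
  have : Finite S := Finite.of_injective f hf
  have : Fintype S := Fintype.ofFinite S
  obtain ⟨e, he⟩ := Finset.exists_equiv_extend_of_card_eq (α := ι) (t := (Finset.univ : Finset κ))
    (s := Finset.univ.image f) (f := g ∘ invFun f) (by simpa using h) (Finset.subset_univ _) <| by
      intro i hi j hj hij
      simp only [Finset.coe_image, Finset.coe_univ, Set.image_univ, Set.mem_range] at hi hj
      obtain ⟨s, rfl⟩ := hi
      obtain ⟨t, rfl⟩ := hj
      simp only [comp_apply, leftInverse_invFun hf _] at hij
      rw [hg hij]
  refine ⟨e.trans (Equiv.subtypeUnivEquiv fun _ => Finset.mem_univ _), fun s => ?_⟩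
  have := he (f s) (Finset.mem_image_of_mem _ (Finset.mem_univ _))
  simpa [leftInverse_invFun hf s] using this

namespace PrefixBasis

variable {X ι κ : Type*}

/-- The words `b (a x)`, for `x` a letter, are the children of a single word. -/
def IsCaret (b : PrefixBasis X ι) (a : X → ι) : Prop := ∃ p, ∀ x, b (a x) = p ++ [x]

theorem IsCaret.injective {b : PrefixBasis X ι} {a : X → ι} (h : b.IsCaret a) : Injective a := by
  obtain ⟨p, hp⟩ := h
  intro x y hxy
  have := hp x
  rw [hxy, hp y] at this
  simpa using this.symm

theorem IsCaret.reindex {b : PrefixBasis X ι} {a : X → κ} (e : κ ≃ ι)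
    (h : b.IsCaret fun x => e (a x)) : (b.reindex e).IsCaret a := h

theorem isCaret_reindex_symm {b : PrefixBasis X ι} {a : X → ι} (e : κ ≃ ι) :
    (b.reindex e).IsCaret (fun x => e.symm (a x)) ↔ b.IsCaret a := by
  simp [IsCaret]

/-- Below every proper prefix of a word of a finite code there is a caret. -/
theorem exists_caret_below [Nonempty X] [Finite ι] (b : PrefixBasis X ι) {p : List X} {i : ι}
    (hp : p <+: b i) (hne : p ≠ b i) : ∃ (a : X → ι) (q : List X), p <+: q ∧
      ∀ x, b (a x) = q ++ [x] := by
  classical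
  have := Fintype.ofFinite ι
  obtain ⟨j, hj, hmax⟩ := Finset.exists_max_image
    (Finset.univ.filter fun j => p <+: b j ∧ p ≠ b j) (fun j => (b j).length) ⟨i, by simp [hp, hne]⟩
  simp only [Finset.mem_filter, Finset.mem_univ, true_and] at hj hmax
  obtain ⟨⟨t, ht⟩, hne'⟩ := hj
  have htne : t ≠ [] := by rintro rfl; simp at ht; exact hne' ht
  obtain ⟨t', x, rfl⟩ := List.eq_nil_or_concat t |>.resolve_left htne
  have hbj : b j = (p ++ t') ++ [x] := by rw [← ht]; simp
  have key : ∀ y, ∃ k, b k = (p ++ t') ++ [y] := by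
    intro y
    obtain ⟨w, hw⟩ := HigmanThompson.exists_isPrefix ((p ++ t') ++ [y])
    obtain ⟨k, hk⟩ := b.exists_isPrefix w
    refine ⟨k, ?_⟩
    have hge : (p ++ t').length < (b k).length := by
      by_contra hlt
      have h1 : b k <+: p ++ t' :=
        hk.prefix_of_length_le (hw.mono (List.prefix_append _ _)) (by omega)
      have h2 := b.eq_of_prefix (h1.trans (hbj ▸ List.prefix_append _ _))
      subst h2
      have := h1.length_le
      rw [hbj] at this
      simp at this
    have h1 : (p ++ t') ++ [y] <+: b k := hw.prefix_of_length_le hk (by simp at hge ⊢; omega)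
    have h2 : p <+: b k := (List.prefix_append p (t' ++ [y])).trans (by simpa using h1)
    have h3 : p ≠ b k := by
      intro h
      rw [← h] at hge
      simp at hge
    have h4 := hmax k ⟨h2, h3⟩
    rw [hbj] at h4
    exact (h1.eq_of_length_le (by simpa using h4)).symm
  choose a ha using key
  exact ⟨a, p ++ t', List.prefix_append _ _, ha⟩

theorem exists_caret [Nonempty X] [Finite ι] [Nontrivial ι] (b : PrefixBasis X ι) :
    ∃ a, b.IsCaret a := by
  obtain ⟨i, j, hij⟩ := exists_pair_ne ι
  have hne : [] ≠ b i := fun h => hij (b.eq_of_prefix (h ▸ List.nil_prefix))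
  obtain ⟨a, q, -, h⟩ := b.exists_caret_below List.nil_prefix hne
  exact ⟨a, q, h⟩

/-- Replace one word by its children. -/
def expand (b : PrefixBasis X (ι ⊕ Unit)) : PrefixBasis X (ι ⊕ X) where
  word := Sum.elim (fun i => b (.inl i)) fun x => b (.inr ()) ++ [x]
  existsUnique_isPrefix w := by
    obtain ⟨i | ⟨⟩, hi⟩ := b.exists_isPrefix w
    · refine ⟨.inl i, hi, ?_⟩
      rintro (j | x) h
      · simpa using b.eq_of_isPrefix h hi
      · exact absurd (b.eq_of_isPrefix (h.mono (List.prefix_append _ _)) hi) (by simp)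
    · obtain ⟨w', rfl⟩ := isPrefix_iff_exists.1 hi
      refine ⟨.inr (w' 0), ?_, ?_⟩
      · simp only [Sum.elim_inr]
        rw [isPrefix_append_appendInf, isPrefix_iff]
        simp
      · rintro (j | x) h
        · exact absurd (b.eq_of_isPrefix h hi) (by simp)
        · simp only [Sum.elim_inr] at h
          rw [isPrefix_append_appendInf, isPrefix_iff] at h
          simpa using (h 0 (by simp)).symm

@[simp]
theorem expand_inl (b : PrefixBasis X (ι ⊕ Unit)) (i : ι) : b.expand (.inl i) = b (.inl i) := rfl

@[simp]
theorem expand_inr (b : PrefixBasis X (ι ⊕ Unit)) (x : X) :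
    b.expand (.inr x) = b (.inr ()) ++ [x] := rfl

@[simp]
theorem elt_expand (b c : PrefixBasis X (ι ⊕ Unit)) : elt b.expand c.expand = elt b c := by
  refine (eq_elt ?_).symm
  rintro (i | x) w
  · simp
  · simp [appendInf_append]

/-- A code with a caret in its last positions is an expansion. -/
theorem exists_expand_eq (b : PrefixBasis X (ι ⊕ X)) (h : b.IsCaret Sum.inr) :
    ∃ b₀ : PrefixBasis X (ι ⊕ Unit), b₀.expand = b := by
  obtain ⟨p, hp⟩ := h
  refine ⟨⟨Sum.elim (fun i => b (.inl i)) fun _ => p, fun w => ?_⟩, ?_⟩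
  · obtain ⟨k, hk⟩ := b.exists_isPrefix w
    have hpw : IsPrefix p w → ∃ x, IsPrefix (b (.inr x)) w := by
      intro h
      obtain ⟨w', rfl⟩ := isPrefix_iff_exists.1 h
      refine ⟨w' 0, ?_⟩
      rw [hp, isPrefix_append_appendInf, isPrefix_iff]
      simp
    rcases k with i | x
    · refine ⟨.inl i, hk, ?_⟩
      rintro (j | ⟨⟩) h
      · simpa using b.eq_of_isPrefix h hk
      · obtain ⟨x, hx⟩ := hpw h
        exact absurd (b.eq_of_isPrefix hx hk) (by simp)
    · refine ⟨.inr (), hk.mono (hp x ▸ List.prefix_append _ _), ?_⟩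
      rintro (j | ⟨⟩) h
      · exact absurd (b.eq_of_isPrefix h hk) (by simp)
      · rfl
  · ext1 (i | x)
    · rfl
    · exact (hp x).symm

/-- Splitting of an index type along an injective family. -/
noncomputable def caretEquiv (a : X → ι) (ha : Injective a) : ↥(Set.range a)ᶜ ⊕ X ≃ ι := by
  classical
  exact (Equiv.sumComm _ _).trans (((Equiv.ofInjective a ha).sumCongr (Equiv.refl _)).trans
    (Equiv.Set.sumCompl (Set.range a)))

@[simp]
theorem caretEquiv_inr (a : X → ι) (ha : Injective a) (x : X) :
    caretEquiv a ha (.inr x) = a x := by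
  simp [caretEquiv]

theorem card_caretEquiv [Fintype ι] [Fintype X] {a : X → ι} (ha : Injective a)
    [Fintype ↥(Set.range a)ᶜ] :
    Fintype.card (↥(Set.range a)ᶜ ⊕ Unit) + Fintype.card X = Fintype.card ι + 1 := by
  have := Fintype.card_congr (caretEquiv a ha)
  simp only [Fintype.card_sum, Fintype.card_unit] at this ⊢
  omega

/-- A caret can be contracted, simultaneously for all codes in which it occurs. -/
theorem IsCaret.exists_contract {b : PrefixBasis X ι} {a : X → ι} (h : b.IsCaret a) :
    ∃ b₀ : PrefixBasis X (↥(Set.range a)ᶜ ⊕ Unit),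
      b₀.expand = b.reindex (caretEquiv a h.injective) :=
  exists_expand_eq _ (IsCaret.reindex _ (by simpa using h))

theorem exists_elt_eq_of_not_caret [Nontrivial X] [Finite ι] {b c : PrefixBasis X ι}
    {b' c' : PrefixBasis X κ} (h : elt b c = elt b' c')
    (hn : ∀ a, b.IsCaret a → ¬ c.IsCaret a) :
    ∃ s : κ → ι, Surjective s ∧ ∀ k, b (s k) <+: b' k := by
  have key : ∀ k, ∃ i, b i <+: b' k := by
    intro k
    obtain ⟨w, hw⟩ := HigmanThompson.exists_isPrefix (b' k)
    obtain ⟨i, hi⟩ := b.exists_isPrefix w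
    refine ⟨i, ?_⟩
    by_contra hcon
    have hpre := (hi.comparable hw).resolve_left hcon
    have hne : b' k ≠ b i := fun h => hcon (h ▸ List.prefix_refl _)
    obtain ⟨a, q, ⟨t, rfl⟩, ha⟩ := b.exists_caret_below hpre hne
    refine hn a ⟨_, ha⟩ ⟨c' k ++ t, fun x => eq_of_appendInf_eq fun w => ?_⟩
    rw [← elt_appendInf b c, ha, h]
    simp only [appendInf_append, elt_appendInf]
  choose s hs using key
  refine ⟨s, fun i => ?_, hs⟩
  obtain ⟨w, hw⟩ := HigmanThompson.exists_isPrefix (b i)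
  obtain ⟨k, hk⟩ := b'.exists_isPrefix w
  exact ⟨k, b.eq_of_isPrefix (hk.mono (hs k)) hw⟩

/-- A table without common carets is determined by the map up to order among the tables that are
not larger. -/
theorem exists_reindex_eq_of_not_caret [Nontrivial X] [Fintype ι] [Fintype κ]
    {b c : PrefixBasis X ι} {b' c' : PrefixBasis X κ} (h : elt b c = elt b' c')
    (hn : ∀ a, b.IsCaret a → ¬ c.IsCaret a) (hcard : Fintype.card κ ≤ Fintype.card ι) :
    ∃ e : κ ≃ ι, b' = b.reindex e ∧ c' = c.reindex e := by
  obtain ⟨s, hs, hpre⟩ := exists_elt_eq_of_not_caret h hn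
  have hbij : Bijective s := (Fintype.bijective_iff_surjective_and_card s).2
    ⟨hs, le_antisymm hcard (Fintype.card_le_of_surjective s hs)⟩
  have hb : ∀ k, b' k = b (s k) := by
    intro k
    have h1 : b' k <+: b (s k) := by
      refine prefix_of_forall_isPrefix fun w hw => ?_
      obtain ⟨k', hk'⟩ := b'.exists_isPrefix w
      obtain rfl := hbij.1 (b.eq_of_isPrefix (hk'.mono (hpre k')) hw)
      exact hk'
    exact h1.eq_of_length (le_antisymm h1.length_le (hpre k).length_le)
  refine ⟨Equiv.ofBijective s hbij, ?_, ?_⟩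
  · ext1 k
    simp [hb]
  · ext1 k
    refine eq_of_appendInf_eq fun w => ?_
    rw [← elt_appendInf b' c', ← h, hb]
    simp

section Counting

variable [Fintype X] [Nontrivial X]

theorem card_induction {P : ∀ (ι : Type) [Fintype ι], Prop}
    (h1 : ∀ (ι : Type) [Fintype ι], Fintype.card ι = 1 → P ι)
    (h : ∀ (ι : Type) [Fintype ι], PrefixBasis X ι → Nontrivial ι →
      (∀ (κ : Type) [Fintype κ], PrefixBasis X κ → Fintype.card κ + Fintype.card X
        = Fintype.card ι + 1 → P κ) → P ι) (ι : Type) [Fintype ι] (b : PrefixBasis X ι) : P ι := by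
  induction hn : Fintype.card ι using Nat.strong_induction_on generalizing ι with
  | _ n ih =>
    subst hn
    rcases subsingleton_or_nontrivial ι with hι | hι
    · have : Nonempty ι := ⟨(b.exists_isPrefix fun _ => Classical.arbitrary X).choose⟩
      exact h1 ι (le_antisymm (Fintype.card_le_one_iff_subsingleton.2 hι) Fintype.card_pos)
    · refine h ι b hι fun κ _ c hc => ih _ ?_ κ c rfl
      have := Fintype.one_lt_card (α := X)
      omega

theorem exists_card_eq (ι : Type) [Fintype ι] (b : PrefixBasis X ι) :
    ∃ k, Fintype.card ι = 1 + k * (Fintype.card X - 1) := by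
  classical
  refine card_induction (X := X)
    (P := fun ι _ => ∃ k, Fintype.card ι = 1 + k * (Fintype.card X - 1))
    (fun ι _ h => ⟨0, by simp [h]⟩) (fun ι _ b hι ih => ?_) ι b
  obtain ⟨a, ha⟩ := b.exists_caret
  obtain ⟨b₀, -⟩ := ha.exists_contract
  have hc := card_caretEquiv ha.injective
  obtain ⟨k, hk⟩ := ih _ b₀ hc
  refine ⟨k + 1, ?_⟩
  have := Fintype.one_lt_card (α := X)
  rw [add_mul]
  omega

theorem length_le_card (ι : Type) [Fintype ι] (b : PrefixBasis X ι) (i : ι) :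
    (b i).length ≤ Fintype.card ι := by
  classical
  refine card_induction (X := X) (P := fun ι _ => ∀ (b : PrefixBasis X ι) (i : ι),
    (b i).length ≤ Fintype.card ι) (fun ι _ h b i => ?_) (fun ι _ b hι ih => ?_) ι b b i
  · have : Subsingleton ι := Fintype.card_le_one_iff_subsingleton.1 h.le
    have hb : b i <+: [] := prefix_of_forall_isPrefix fun w _ => by
      obtain ⟨j, hj⟩ := b.exists_isPrefix w
      rwa [Subsingleton.elim i j]
    simp [List.prefix_nil.1 hb]
  · clear b
    intro b i
    obtain ⟨a, ha⟩ := b.exists_caret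
    obtain ⟨b₀, hb₀⟩ := ha.exists_contract
    have hc := card_caretEquiv ha.injective
    have hX := Fintype.one_lt_card (α := X)
    have hl := ih _ b₀ hc b₀
    obtain ⟨k, rfl⟩ := (caretEquiv a ha.injective).surjective i
    rw [← reindex_apply, ← hb₀]
    rcases k with j | x
    · have := hl (.inl j)
      rw [expand_inl]; omega
    · have := hl (.inr ())
      simp only [expand_inr, List.length_append, List.length_singleton]; omega

end Counting

section Existence

/-- Replace the word with index `i` by its children. -/
theorem exists_expand {ι : Type} {X : Type} [Fintype X] [Fintype ι] (b : PrefixBasis X ι) (i : ι) :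
    ∃ (κ : Type) (_ : Fintype κ) (c : PrefixBasis X κ),
      Fintype.card κ + 1 = Fintype.card ι + Fintype.card X ∧
      (∀ j ≠ i, ∃ k, c k = b j) ∧ ∀ x, ∃ k, c k = b i ++ [x] := by
  classical
  let a : Unit → ι := fun _ => i
  have ha : Injective a := fun _ _ _ => rfl
  let e := caretEquiv a ha
  have hi : e (.inr ()) = i := caretEquiv_inr a ha ()
  have hc := Fintype.card_congr e
  refine ⟨↥(Set.range a)ᶜ ⊕ X, inferInstance, (b.reindex e).expand, ?_, fun j hj => ?_,
    fun x => ⟨.inr x, by simp [hi]⟩⟩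
  · simp only [Fintype.card_sum, Fintype.card_unit] at hc ⊢
    omega
  · obtain ⟨k | ⟨⟩, rfl⟩ := e.surjective j
    · exact ⟨.inl k, by simp⟩
    · exact absurd hi hj

/-- Expand a code along a word below the word with index `i`. -/
theorem exists_expand_along {ι X : Type} [Fintype X] [Nonempty X] [Fintype ι]
    (b : PrefixBasis X ι) (i : ι) (s : List X) :
    ∃ (κ : Type) (_ : Fintype κ) (c : PrefixBasis X κ),
      Fintype.card κ = Fintype.card ι + s.length * (Fintype.card X - 1) ∧
      (∀ j ≠ i, ∃ k, c k = b j) ∧ ∃ k, c k = b i ++ s := by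
  induction s using List.reverseRecOn with
  | nil => exact ⟨ι, inferInstance, b, by simp, fun j _ => ⟨j, rfl⟩, i, by simp⟩
  | append_singleton s x ih =>
    obtain ⟨κ, _, c, hc, h1, k₀, hk₀⟩ := ih
    obtain ⟨l, _, e, he, h2, h3⟩ := c.exists_expand k₀
    refine ⟨l, inferInstance, e, ?_, fun j hj => ?_, ?_⟩
    · have := Fintype.card_pos (α := X)
      simp only [List.length_append, List.length_singleton, add_mul]
      omega
    · obtain ⟨k, hk⟩ := h1 j hj
      rw [← hk]
      refine h2 k ?_
      rintro rfl
      exact hj (b.eq_of_prefix (hk ▸ hk₀ ▸ List.prefix_append _ _)).symm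
    · obtain ⟨k, hk⟩ := h3 x
      exact ⟨k, by rw [hk, hk₀, List.append_assoc]⟩

/-- The code of all words of length `n`. -/
def level (X : Type*) (n : ℕ) : PrefixBasis X (Fin n → X) where
  word := List.ofFn
  existsUnique_isPrefix w := by
    refine ⟨fun i => w i, isPrefix_iff.2 (by simp), fun v hv => ?_⟩
    ext i
    simpa using (isPrefix_iff.1 hv i (by simp)).symm

@[simp]
theorem length_level (X : Type*) (n : ℕ) (v : Fin n → X) : (level X n v).length = n := by
  simp [level]

/-- The code of all letters. -/
def letters (X : Type*) : PrefixBasis X X where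
  word x := [x]
  existsUnique_isPrefix w :=
    ⟨w 0, isPrefix_iff.2 (by simp), fun x hx => by simpa using (isPrefix_iff.1 hx 0 (by simp)).symm⟩

/-- Refine every word of a code in the same way. -/
def prod (b : PrefixBasis X ι) (t : PrefixBasis X κ) : PrefixBasis X (ι × κ) where
  word p := b p.1 ++ t p.2
  existsUnique_isPrefix w := by
    obtain ⟨i, hi⟩ := b.exists_isPrefix w
    obtain ⟨w', rfl⟩ := isPrefix_iff_exists.1 hi
    obtain ⟨k, hk⟩ := t.exists_isPrefix w'
    refine ⟨(i, k), isPrefix_append_appendInf.2 hk, ?_⟩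
    rintro ⟨i', k'⟩ h
    obtain rfl := b.eq_of_isPrefix hi (h.mono (List.prefix_append _ _))
    obtain rfl : k' = k := t.eq_of_isPrefix (isPrefix_append_appendInf.1 h) hk
    rfl

@[simp]
theorem prod_apply (b : PrefixBasis X ι) (t : PrefixBasis X κ) (p : ι × κ) :
    b.prod t p = b p.1 ++ t p.2 := rfl

@[simp]
theorem elt_prod (b c : PrefixBasis X ι) (t : PrefixBasis X κ) :
    elt (b.prod t) (c.prod t) = elt b c :=
  (eq_elt fun p w => by simp [appendInf_append]).symm

end Existence

end PrefixBasis

section Cocycle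

variable {A V B : Type*} [Group A]

/-- A multiplicative cocycle on the edges of a graph in which any four vertices have a common
neighbour is a coboundary. -/
theorem exists_coboundary {adj : V → V → Prop} (hsymm : ∀ {a b}, adj a b → adj b a)
    (h4 : ∀ a b c e, ∃ u, adj a u ∧ adj b u ∧ adj c u ∧ adj e u) (k : V → V → A)
    (hk : ∀ {a b c}, adj a b → adj b c → adj a c → k b c * k a b = k a c) :
    ∃ p : V → A, ∀ a b, adj a b → p b = k a b * p a := by
  rcases isEmpty_or_nonempty V with hV | ⟨⟨o⟩⟩
  · exact ⟨fun _ => 1, fun a => hV.elim a⟩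
  have hw : ∀ v, ∃ w, adj o w ∧ adj w v := fun v => by
    obtain ⟨u, h1, h2, -, -⟩ := h4 o v v v
    exact ⟨u, h1, hsymm h2⟩
  have huniq : ∀ {v w w'}, adj o w → adj w v → adj o w' → adj w' v →
      k w v * k o w = k w' v * k o w' := by
    intro v w w' h1 h2 h1' h2'
    obtain ⟨u, h3, h4, h5, h6⟩ := h4 o v w w'
    have aux : ∀ {w}, adj o w → adj w v → adj w u → k u v * k o u = k w v * k o w := by
      intro w h1 h2 h5
      rw [← hk h1 h5 h3, ← mul_assoc, hk h5 (hsymm h4) h2]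
    rw [← aux h1 h2 h5, aux h1' h2' h6]
  choose w hw1 hw2 using hw
  refine ⟨fun v => k (w v) v * k o (w v), fun a b hab => ?_⟩
  obtain ⟨u, h1, h2, h3, -⟩ := h4 o a b b
  dsimp only
  rw [huniq (hw1 b) (hw2 b) h1 (hsymm h3), huniq (hw1 a) (hw2 a) h1 (hsymm h2), ← mul_assoc,
    hk (hsymm h2) hab (hsymm h3)]

variable {adj : V → V → Prop} {mem : B → V → Prop}

/-- A cocycle defined on pairs lying in a common member of a cover is a coboundary if the nerve of
the cover is a flag complex in which any four vertices have a common neighbour. -/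
theorem exists_coboundary_of_cover (hsymm : ∀ {a b}, adj a b → adj b a)
    (h4 : ∀ a b c e, ∃ u, adj a u ∧ adj b u ∧ adj c u ∧ adj e u)
    (h3 : ∀ a b c, adj a b → adj b c → adj a c → ∃ y, mem y a ∧ mem y b ∧ mem y c)
    (hmem : ∀ b, ∃ v, mem b v) (hadj : ∀ {b v v'}, mem b v → mem b v' → v = v' ∨ adj v v')
    (F : B → B → A) (hF : ∀ {v b c e}, mem b v → mem c v → mem e v → F c e * F b c = F b e) :
    ∃ h : B → A, ∀ {v b c}, mem b v → mem c v → F b c = h c * (h b)⁻¹ := by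
  rcases isEmpty_or_nonempty B with hB | hB
  · exact ⟨fun _ => 1, fun {_ b} => hB.elim b⟩
  have h2 : ∀ a b, adj a b → ∃ y, mem y a ∧ mem y b := fun a b hab => by
    obtain ⟨u, ha, hb, -, -⟩ := h4 a b b b
    obtain ⟨y, h1, h2, -⟩ := h3 a b u hab hb ha
    exact ⟨y, h1, h2⟩
  have h1 : ∀ a, ∃ y, mem y a := fun a => by
    obtain ⟨u, ha, -⟩ := h4 a a a a
    obtain ⟨y, h, -⟩ := h2 a u ha
    exact ⟨y, h⟩
  have hF1 : ∀ {v b}, mem b v → F b b = 1 := fun hb => mul_eq_left.1 (hF hb hb hb)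
  choose p hp using h1
  choose! y hy1 hy2 using h2
  have hy : ∀ {a b z}, adj a b → mem z a → mem z b →
      F (y a b) (p b) * F (p a) (y a b) = F z (p b) * F (p a) z := by
    intro a b z hab hza hzb
    rw [← hF (hp a) (hy1 a b hab) hza, ← mul_assoc, hF (hy2 a b hab) hzb (hp b)]
  obtain ⟨q, hq⟩ := exists_coboundary hsymm h4 (fun a b => F (y a b) (p b) * F (p a) (y a b)) <| by
    intro a b c hab hbc hac
    obtain ⟨z, hza, hzb, hzc⟩ := h3 a b c hab hbc hac
    rw [hy hab hza hzb, hy hbc hzb hzc, hy hac hza hzc, mul_assoc, ← mul_assoc (F (p b) z),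
      hF hzb (hp b) hzb, hF1 hzb, one_mul]
  choose v hv using hmem
  have hind : ∀ {b u}, mem b u → F (p (v b)) b * q (v b) = F (p u) b * q u := by
    intro b u hb
    rcases hadj (hv b) hb with rfl | huv
    · rfl
    · rw [hq _ _ huv, hy huv (hv b) hb, ← mul_assoc, ← mul_assoc, hF hb (hp u) hb, hF1 hb, one_mul]
  refine ⟨fun b => F (p (v b)) b * q (v b), fun {u b c} hb hc => ?_⟩
  dsimp only
  rw [hind hb, hind hc, ← hF (hp u) hb hc]
  group

/-- A function that is constant on the members of a cover with connected nerve is constant. -/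
theorem eq_of_cover {C : Type*}
    (h4 : ∀ a b c e, ∃ u, adj a u ∧ adj b u ∧ adj c u ∧ adj e u)
    (h3 : ∀ a b c, adj a b → adj b c → adj a c → ∃ y, mem y a ∧ mem y b ∧ mem y c)
    (hmem : ∀ b, ∃ v, mem b v) (f : B → C) (hf : ∀ {v b c}, mem b v → mem c v → f b = f c)
    (b c : B) : f b = f c := by
  have h2 : ∀ a b, adj a b → ∃ y, mem y a ∧ mem y b := fun a b hab => by
    obtain ⟨u, ha, hb, -, -⟩ := h4 a b b b
    obtain ⟨y, h1, h2, -⟩ := h3 a b u hab hb ha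
    exact ⟨y, h1, h2⟩
  obtain ⟨v, hv⟩ := hmem b
  obtain ⟨w, hw⟩ := hmem c
  obtain ⟨u, h1, h2', -, -⟩ := h4 v w w w
  obtain ⟨y, hyv, hyu⟩ := h2 v u h1
  obtain ⟨z, hzw, hzu⟩ := h2 w u h2'
  exact (hf hv hyv).trans ((hf hyu hzu).trans (hf hzw hw))

end Cocycle

namespace PrefixBasis

variable {X : Type}

/-- Every word of a code survives in some code of a prescribed larger size, except for one word
that we are free to choose. -/
theorem exists_of_card_le [Fintype X] [Nontrivial X] {ι κ : Type} [Fintype ι] [Fintype κ]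
    (b : PrefixBasis X ι) (i : ι) (c : PrefixBasis X κ) (h : Fintype.card ι ≤ Fintype.card κ) :
    ∃ b' : PrefixBasis X κ, (∀ j ≠ i, ∃ k, b' k = b j) ∧ ∃ k, b i <+: b' k := by
  obtain ⟨m, hm⟩ := exists_card_eq ι b
  obtain ⟨n, hn⟩ := exists_card_eq κ c
  have hX := Fintype.one_lt_card (α := X)
  have hmn : m ≤ n := by
    rw [hm, hn] at h
    exact Nat.le_of_mul_le_mul_right (by omega) (show 0 < Fintype.card X - 1 by omega)
  obtain ⟨l, _, e, hl, h1, k, hk⟩ :=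
    b.exists_expand_along i (List.replicate (n - m) (Classical.arbitrary X))
  have hcard : Fintype.card κ = Fintype.card l := by
    rw [hl, hm, hn, List.length_replicate, add_assoc, ← add_mul, Nat.add_sub_cancel' hmn]
  let φ := Fintype.equivOfCardEq hcard
  refine ⟨e.reindex φ, fun j hj => ?_, φ.symm k, by simp [hk]⟩
  obtain ⟨k, hk⟩ := h1 j hj
  exact ⟨φ.symm k, by simp [hk]⟩

/-- There are codes with three given disjoint carets. -/
theorem exists_isCaret_three [Fintype X] [Nontrivial X] {κ : Type} [Fintype κ]
    (c : PrefixBasis X κ) (h : Fintype.card X ^ 3 ≤ Fintype.card κ) (a : Fin 3 × X → κ)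
    (ha : Injective a) : ∃ b : PrefixBasis X κ, ∀ j, b.IsCaret fun x => a (j, x) := by
  classical
  have hX := Fintype.one_lt_card (α := X)
  obtain ⟨f⟩ : Nonempty (Fin 4 ↪ (Fin 2 → X)) := by
    rw [Function.Embedding.nonempty_iff_card_le]
    simpa using (show 4 ≤ Fintype.card X ^ 2 by nlinarith)
  obtain ⟨b, hb, -⟩ := ((level X 2).prod (letters X)).exists_of_card_le
    (f 3, Classical.arbitrary X) c (by simpa [← pow_succ] using h)
  have key : ∀ p : Fin 3 × X, ∃ k, b k = ((level X 2).prod (letters X)) (f p.1.castSucc, p.2) :=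
    fun p => hb _ (by
      intro h
      have := f.injective (Prod.ext_iff.1 h).1
      exact (Fin.castSucc_lt_last p.1).ne this)
  choose s hs using key
  have hsi : Injective s := fun p q h => by
    have := PrefixBasis.injective _ ((hs p).symm.trans ((congrArg b h).trans (hs q)))
    rw [Prod.ext_iff] at this
    exact Prod.ext ((Fin.castSucc_injective _) (f.injective this.1)) this.2
  obtain ⟨e, he⟩ := exists_equiv_comp_eq rfl ha hsi
  refine ⟨b.reindex e, fun j => ⟨level X 2 (f j.castSucc), fun x => ?_⟩⟩
  rw [reindex_apply, he, hs]
  rfl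

theorem exists_isCaret_of_disjoint [Fintype X] [Nontrivial X] {κ : Type} [Fintype κ]
    (c : PrefixBasis X κ) (h : Fintype.card X ^ 3 ≤ Fintype.card κ) {a₁ a₂ a₃ : X → κ}
    (h₁ : Injective a₁) (h₂ : Injective a₂) (h₃ : Injective a₃)
    (h₁₂ : Disjoint (Set.range a₁) (Set.range a₂)) (h₂₃ : Disjoint (Set.range a₂) (Set.range a₃))
    (h₁₃ : Disjoint (Set.range a₁) (Set.range a₃)) :
    ∃ b : PrefixBasis X κ, b.IsCaret a₁ ∧ b.IsCaret a₂ ∧ b.IsCaret a₃ := by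
  have hne : ∀ {a b : X → κ}, Disjoint (Set.range a) (Set.range b) → ∀ x y, a x ≠ b y :=
    fun h x y hxy => Set.disjoint_left.1 h ⟨x, rfl⟩ ⟨y, hxy.symm⟩
  obtain ⟨y, hy⟩ := exists_isCaret_three c h (fun p => ![a₁, a₂, a₃] p.1 p.2) (by
    rintro ⟨i, x⟩ ⟨j, y⟩ h
    fin_cases i <;> fin_cases j <;> simp only [Fin.zero_eta, Fin.mk_one, Fin.reduceFinMk,
      Matrix.cons_val] at h
    · rw [h₁ h]
    · exact absurd h (hne h₁₂ _ _)
    · exact absurd h (hne h₁₃ _ _)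
    · exact absurd h.symm (hne h₁₂ _ _)
    · rw [h₂ h]
    · exact absurd h (hne h₂₃ _ _)
    · exact absurd h.symm (hne h₁₃ _ _)
    · exact absurd h.symm (hne h₂₃ _ _)
    · rw [h₃ h])
  exact ⟨y, hy 0, hy 1, hy 2⟩

/-- Two carets of a code are equal or disjoint. -/
theorem IsCaret.eq_or_disjoint [Nonempty X] {ι : Type} {b : PrefixBasis X ι} {a a' : X → ι}
    (h : b.IsCaret a) (h' : b.IsCaret a') :
    a = a' ∨ Disjoint (Set.range a) (Set.range a') := by
  obtain ⟨p, hp⟩ := h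
  obtain ⟨q, hq⟩ := h'
  by_cases hpq : p = q
  · left
    ext x
    exact b.injective (by rw [hp, hq, hpq])
  · right
    rw [Set.disjoint_left]
    rintro _ ⟨x, rfl⟩ ⟨y, hxy⟩
    have := hq y
    rw [hxy, hp] at this
    exact hpq (List.append_inj_left' this rfl)

/-- Four families have a common disjoint family. -/
theorem exists_disjoint_range {ι : Type} [Fintype ι] [Fintype X]
    (h : 5 * Fintype.card X ≤ Fintype.card ι) (a b c e : X → ι) :
    ∃ u : X → ι, Injective u ∧ Disjoint (Set.range a) (Set.range u) ∧
      Disjoint (Set.range b) (Set.range u) ∧ Disjoint (Set.range c) (Set.range u) ∧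
      Disjoint (Set.range e) (Set.range u) := by
  classical
  let s : Finset ι := Finset.univ.image a ∪ Finset.univ.image b ∪
    (Finset.univ.image c ∪ Finset.univ.image e)
  have hi : ∀ f : X → ι, (Finset.univ.image f).card ≤ Fintype.card X := fun f =>
    Finset.card_image_le
  have hs : s.card ≤ 4 * Fintype.card X := by
    have h1 : s.card ≤ _ := Finset.card_union_le (Finset.univ.image a ∪ Finset.univ.image b)
      (Finset.univ.image c ∪ Finset.univ.image e)
    have h2 := Finset.card_union_le (Finset.univ.image a) (Finset.univ.image b)
    have h3 := Finset.card_union_le (Finset.univ.image c) (Finset.univ.image e)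
    have := hi a
    have := hi b
    have := hi c
    have := hi e
    omega
  obtain ⟨u⟩ : Nonempty (X ↪ ↥sᶜ) := by
    rw [Function.Embedding.nonempty_iff_card_le, Fintype.card_coe, Finset.card_compl]
    omega
  have hu : ∀ x, (u x : ι) ∉ s := fun x => Finset.mem_compl.1 (u x).2
  refine ⟨fun x => u x, Subtype.val_injective.comp u.injective, ?_, ?_, ?_, ?_⟩ <;>
  · rw [Set.disjoint_right]
    rintro _ ⟨x, rfl⟩ ⟨y, hy⟩
    apply hu x
    simp [s, ← hy]

/-- Large codes are connected to each other through common carets. -/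
theorem eq_of_isCaret [Fintype X] [Nontrivial X] {ι : Type} {C : Type*} [Fintype ι]
    (h5 : 5 * Fintype.card X ≤ Fintype.card ι) (h3 : Fintype.card X ^ 3 ≤ Fintype.card ι)
    (f : PrefixBasis X ι → C) (hf : ∀ b c a, b.IsCaret a → c.IsCaret a → f b = f c)
    (b c : PrefixBasis X ι) : f b = f c := by
  have hX := Fintype.one_lt_card (α := X)
  have : Nontrivial ι := Fintype.one_lt_card_iff_nontrivial.1 (by omega)
  refine eq_of_cover (V := {a : X → ι // Injective a})
    (adj := fun a a' => Disjoint (Set.range a.1) (Set.range a'.1))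
    (mem := fun b a => b.IsCaret a.1) (fun a b c e => ?_)
    (fun a₁ a₂ a₃ h₁₂ h₂₃ h₁₃ => ?_) (fun b => ?_) f (fun {a b c} => hf b c a) b c
  · obtain ⟨u, hu, h⟩ := exists_disjoint_range h5 a.1 b.1 c.1 e.1
    exact ⟨⟨u, hu⟩, h⟩
  · exact b.exists_isCaret_of_disjoint h3 a₁.2 a₂.2 a₃.2 h₁₂ h₂₃ h₁₃
  · obtain ⟨a, ha⟩ := b.exists_caret
    exact ⟨⟨a, ha.injective⟩, ha⟩

/-- `f` is multiplicative on tables of size at most `n`. -/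
def Coherent {A : Type*} [Group A] (X : Type) (f : Equiv.Perm (ℕ → X) → A) (n : ℕ) : Prop :=
  ∀ (ι : Type) [Fintype ι], Fintype.card ι ≤ n → ∀ b c e : PrefixBasis X ι,
    f (elt c e) * f (elt b c) = f (elt b e)

section Extension

variable {A : Type*} [Group A] [Fintype X] [Nontrivial X]
  {f : Equiv.Perm (ℕ → X) → A} {n : ℕ}

/-- A function that is multiplicative on small tables is described by a potential on the codes of
the next size. -/
theorem Coherent.exists_potential (hf : Coherent X f n) (hn : 5 * Fintype.card X ≤ n + 1)
    (hn' : Fintype.card X ^ 3 ≤ n + 1) : ∃ h : PrefixBasis X (Fin (n + 1)) → A,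
      (∀ b c a, b.IsCaret a → c.IsCaret a → f (elt b c) = h c * (h b)⁻¹) ∧
      ∀ b c (e : Equiv.Perm (Fin (n + 1))),
        h (c.reindex e) * (h (b.reindex e))⁻¹ = h c * (h b)⁻¹ := by
  classical
  rcases isEmpty_or_nonempty (PrefixBasis X (Fin (n + 1))) with hB | ⟨⟨c₀⟩⟩
  · exact ⟨fun _ => 1, fun b => hB.elim b, fun b => hB.elim b⟩
  have hX := Fintype.one_lt_card (α := X)
  have : Nontrivial (Fin (n + 1)) := Fintype.one_lt_card_iff_nontrivial.1 (by simp; omega)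
  let V := {a : X → Fin (n + 1) // Injective a}
  let adj : V → V → Prop := fun a a' => Disjoint (Set.range a.1) (Set.range a'.1)
  let mem : PrefixBasis X (Fin (n + 1)) → V → Prop := fun b a => b.IsCaret a.1
  have hsymm : ∀ {a b}, adj a b → adj b a := fun h => h.symm
  have h4 : ∀ a b c e, ∃ u, adj a u ∧ adj b u ∧ adj c u ∧ adj e u := fun a b c e => by
    obtain ⟨u, hu, h⟩ := exists_disjoint_range (by simpa using hn) a.1 b.1 c.1 e.1
    exact ⟨⟨u, hu⟩, h⟩
  have h3 : ∀ a b c, adj a b → adj b c → adj a c → ∃ y, mem y a ∧ mem y b ∧ mem y c :=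
    fun a b c hab hbc hac =>
      c₀.exists_isCaret_of_disjoint (by simpa using hn') a.2 b.2 c.2 hab hbc hac
  have hmem : ∀ b, ∃ v, mem b v := fun b => by
    obtain ⟨a, ha⟩ := b.exists_caret
    exact ⟨⟨a, ha.injective⟩, ha⟩
  have hadj : ∀ {b v v'}, mem b v → mem b v' → v = v' ∨ adj v v' := fun h h' =>
    (h.eq_or_disjoint h').imp_left Subtype.ext
  have hF : ∀ {v b c e}, mem b v → mem c v → mem e v →
      f (elt c e) * f (elt b c) = f (elt b e) := by
    intro v b c e hb hc he
    obtain ⟨b₀, hb₀⟩ := hb.exists_contract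
    obtain ⟨c₀, hc₀⟩ := hc.exists_contract
    obtain ⟨e₀, he₀⟩ := he.exists_contract
    have key : ∀ {b c : PrefixBasis X (Fin (n + 1))} {b₀ c₀},
        b₀.expand = b.reindex (caretEquiv v.1 v.2) →
        c₀.expand = c.reindex (caretEquiv v.1 v.2) → elt b c = elt b₀ c₀ := by
      intro b c b₀ c₀ hb hc
      rw [← elt_expand, hb, hc, elt_reindex]
    rw [key hc₀ he₀, key hb₀ hc₀, key hb₀ he₀]
    refine hf _ ?_ _ _ _
    have := card_caretEquiv v.2
    rw [Fintype.card_fin] at this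
    omega
  obtain ⟨h, hh⟩ := exists_coboundary_of_cover hsymm h4 h3 hmem hadj (fun b c => f (elt b c)) hF
  refine ⟨h, fun b c a hb hc => hh (v := ⟨a, hb.injective⟩) hb hc, fun b c e => ?_⟩
  have := eq_of_isCaret (by simpa using hn) (by simpa using hn')
    (fun b => (h b)⁻¹ * h (b.reindex e)) (by
    intro b c a hb hc
    have h1 := hh (v := ⟨a, hb.injective⟩) hb hc
    have h2 := hh (v := ⟨fun x => e.symm (a x), e.symm.injective.comp hb.injective⟩)
      ((isCaret_reindex_symm e).2 hb) ((isCaret_reindex_symm e).2 hc)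
    simp only [elt_reindex] at h2
    rw [h1, eq_mul_inv_iff_mul_eq] at h2
    rw [← h2]
    group) b c
  rw [inv_mul_eq_iff_eq_mul] at this
  rw [this]
  group

/-- Extension of a function that is multiplicative on small tables by one step. -/
theorem Coherent.exists_extend (hf : Coherent X f n) (hn : 5 * Fintype.card X ≤ n + 1)
    (hn' : Fintype.card X ^ 3 ≤ n + 1) : ∃ f' : Equiv.Perm (ℕ → X) → A, Coherent X f' (n + 1) ∧
      ∀ (ι : Type) [Fintype ι], Fintype.card ι ≤ n → ∀ b c : PrefixBasis X ι,
        f' (elt b c) = f (elt b c) := by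
  classical
  obtain ⟨h, h1, h2⟩ := hf.exists_potential hn hn'
  let f' : Equiv.Perm (ℕ → X) → A := fun g =>
    if hg : ∃ p : PrefixBasis X (Fin (n + 1)) × PrefixBasis X (Fin (n + 1)), g = elt p.1 p.2
    then h hg.choose.2 * (h hg.choose.1)⁻¹ else f g
  have hwd : ∀ b c b' c' : PrefixBasis X (Fin (n + 1)), elt b c = elt b' c' →
      h c * (h b)⁻¹ = h c' * (h b')⁻¹ := by
    intro b c b' c' heq
    have aux : ∀ {b c b' c' : PrefixBasis X (Fin (n + 1))}, elt b c = elt b' c' →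
        (∀ a, b.IsCaret a → ¬ c.IsCaret a) → h c * (h b)⁻¹ = h c' * (h b')⁻¹ := by
      intro b c b' c' heq hno
      obtain ⟨e, rfl, rfl⟩ := exists_reindex_eq_of_not_caret heq hno le_rfl
      exact (h2 b c e).symm
    by_cases hno : ∀ a, b.IsCaret a → ¬ c.IsCaret a
    · exact aux heq hno
    by_cases hno' : ∀ a, b'.IsCaret a → ¬ c'.IsCaret a
    · exact (aux heq.symm hno').symm
    push Not at hno hno'
    obtain ⟨a, ha, ha'⟩ := hno
    obtain ⟨a', hb, hb'⟩ := hno'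
    rw [← h1 b c a ha ha', heq, h1 b' c' a' hb hb']
  have hf' : ∀ b c : PrefixBasis X (Fin (n + 1)), f' (elt b c) = h c * (h b)⁻¹ := by
    intro b c
    have hg : ∃ p : PrefixBasis X (Fin (n + 1)) × PrefixBasis X (Fin (n + 1)),
      elt b c = elt p.1 p.2 := ⟨(b, c), rfl⟩
    simp only [f', dif_pos hg]
    exact hwd _ _ _ _ hg.choose_spec.symm
  have hagree : ∀ (ι : Type) [Fintype ι], Fintype.card ι ≤ n → ∀ b c : PrefixBasis X ι,
      f' (elt b c) = f (elt b c) := by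
    intro ι _ hι b c
    by_cases hg : ∃ p : PrefixBasis X (Fin (n + 1)) × PrefixBasis X (Fin (n + 1)),
        elt b c = elt p.1 p.2
    · obtain ⟨⟨b', c'⟩, hbc⟩ := hg
      dsimp only at hbc
      rw [hbc, hf']
      by_contra hne
      have hno : ∀ a, b'.IsCaret a → ¬ c'.IsCaret a := fun a ha ha' =>
        hne (h1 b' c' a ha ha').symm
      obtain ⟨e, -⟩ := exists_reindex_eq_of_not_caret hbc.symm hno
        (by rw [Fintype.card_fin]; omega)
      have := Fintype.card_congr e
      rw [Fintype.card_fin] at this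
      omega
    · simp only [f', dif_neg hg]
  refine ⟨f', fun ι _ hι b c e => ?_, hagree⟩
  rcases hι.lt_or_eq with hlt | heq
  · have hι : Fintype.card ι ≤ n := by omega
    rw [hagree ι hι, hagree ι hι, hagree ι hι]
    exact hf ι hι b c e
  · let φ := (Fintype.equivFinOfCardEq heq).symm
    rw [← elt_reindex c e φ, ← elt_reindex b c φ, ← elt_reindex b e φ, hf', hf', hf']
    group

/-- A function that is multiplicative on small tables extends to a homomorphism. -/
theorem Coherent.exists_monoidHom (hf : Coherent X f n) (hn : 5 * Fintype.card X ≤ n + 1)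
    (hn' : Fintype.card X ^ 3 ≤ n + 1) : ∃ F : tableGroup X →* A,
      ∀ (ι : Type) [Fintype ι], Fintype.card ι ≤ n → ∀ b c : PrefixBasis X ι,
        F ⟨elt b c, isTableMap_elt b c⟩ = f (elt b c) := by
  classical
  choose! ext hext1 hext2 using fun (f : Equiv.Perm (ℕ → X) → A) (m : ℕ)
    (h : Coherent X f m ∧ 5 * Fintype.card X ≤ m + 1 ∧ Fintype.card X ^ 3 ≤ m + 1) =>
    h.1.exists_extend h.2.1 h.2.2
  let s : ℕ → Equiv.Perm (ℕ → X) → A := fun k => Nat.rec f (fun k f => ext f (n + k)) k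
  have hs : ∀ k, Coherent X (s k) (n + k) := by
    intro k
    induction k with
    | zero => exact hf
    | succ k ih => exact hext1 _ _ ⟨ih, by omega, by omega⟩
  have hstep : ∀ k l, ∀ (ι : Type) [Fintype ι], Fintype.card ι ≤ n + k →
      ∀ b c : PrefixBasis X ι, s (k + l) (elt b c) = s k (elt b c) := by
    intro k l ι _ hι b c
    induction l with
    | zero => rfl
    | succ l ih =>
      rw [← ih]
      exact hext2 _ _ ⟨hs _, by omega, by omega⟩ ι (hι.trans (by rw [Nat.add_eq]; omega)) b c
  let N : Equiv.Perm (ℕ → X) → ℕ := fun g =>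
    if hg : IsTableMap g then (isTableMap_iff.1 hg).choose else 0
  have hval : ∀ k, ∀ (ι : Type) [Fintype ι], Fintype.card ι ≤ n + k →
      ∀ b c : PrefixBasis X ι, s (N (elt b c)) (elt b c) = s k (elt b c) := by
    intro k ι _ hι b c
    have hg := isTableMap_elt b c
    obtain ⟨m, b', c', hN, h⟩ : ∃ (m : ℕ) (b' c' : PrefixBasis X (Fin m)),
        N (elt b c) = m ∧ elt b c = elt b' c' := by
      obtain ⟨b', c', h⟩ := (isTableMap_iff.1 hg).choose_spec
      exact ⟨_, b', c', dif_pos hg, h⟩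
    rw [hN, ← hstep k m ι hι b c, h, add_comm k m]
    exact (hstep m k (Fin _) (by rw [Fintype.card_fin]; omega) b' c').symm
  refine ⟨MonoidHom.mk' (fun g => s (N g.1) g.1) ?_, fun ι _ hι b c => ?_⟩
  · rintro ⟨g, hg⟩ ⟨h, hh⟩
    obtain ⟨m, b, c, e, rfl, rfl⟩ := exists_elt_elt hh hg
    simp only [MulMemClass.mk_mul_mk, elt_mul_elt]
    have hm : Fintype.card (Fin m) ≤ n + m := by simp
    rw [hval m _ hm, hval m _ hm, hval m _ hm]
    exact (hs m _ hm b c e).symm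
  · exact hval 0 ι hι b c

end Extension

theorem IsCaret.exists_elt_eq {ι : Type} {b c : PrefixBasis X ι} {a : X → ι} (hb : b.IsCaret a)
    (hc : c.IsCaret a) : ∃ b₀ c₀ : PrefixBasis X (↥(Set.range a)ᶜ ⊕ Unit), elt b c = elt b₀ c₀ := by
  obtain ⟨b₀, hb₀⟩ := hb.exists_contract
  obtain ⟨c₀, hc₀⟩ := hc.exists_contract
  exact ⟨b₀, c₀, by rw [← elt_expand, hb₀, hc₀, elt_reindex]⟩

/-- The table group is generated by the tables of bounded size. -/
theorem elt_mem_of_small [Fintype X] [Nontrivial X] (n : ℕ) (hn : 5 * Fintype.card X ≤ n + 1)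
    (hn' : Fintype.card X ^ 3 ≤ n + 1) (G : Subgroup (Equiv.Perm (ℕ → X)))
    (hG : ∀ (ι : Type) [Fintype ι], Fintype.card ι ≤ n → ∀ b c : PrefixBasis X ι, elt b c ∈ G)
    (ι : Type) [Fintype ι] (b c : PrefixBasis X ι) : elt b c ∈ G := by
  classical
  have hX := Fintype.one_lt_card (α := X)
  induction hm : Fintype.card ι using Nat.strong_induction_on generalizing ι with
  | _ m ih =>
    subst hm
    rcases le_or_gt (Fintype.card ι) n with hle | hlt
    · exact hG ι hle b c
    · have := eq_of_isCaret (by omega) (by omega)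
        (fun b' => (QuotientGroup.mk (elt b' b) : Equiv.Perm (ℕ → X) ⧸ G)) (by
          intro e e' a he he'
          rw [QuotientGroup.eq, elt_inv, elt_mul_elt]
          obtain ⟨e₀, e₀', h⟩ := he'.exists_elt_eq he
          rw [h]
          have := card_caretEquiv he.injective
          exact ih _ (by omega) _ _ _ rfl) c b
      rwa [elt_self, eq_comm, QuotientGroup.eq, inv_one, one_mul, ← inv_mem_iff, elt_inv] at this

instance [Finite X] [Nontrivial X] (m : ℕ) : Finite (PrefixBasis X (Fin m)) := by
  have := Fintype.ofFinite X
  have := (List.finite_length_le X m).to_subtype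
  refine Finite.of_injective (β := Fin m → {l : List X | l.length ≤ m})
    (fun b i => ⟨b i, by simpa using length_le_card (Fin m) b i⟩) fun b c h => ?_
  ext1 i
  simpa using congrFun h i

end PrefixBasis

open PrefixBasis in
/-- The table group is finitely presented. -/
theorem isFinitelyPresented_tableGroup (X : Type) [Fintype X] [Nontrivial X] :
    Group.IsFinitelyPresented (tableGroup X) := by
  classical
  obtain ⟨n, hn, hn'⟩ : ∃ n, 5 * Fintype.card X ≤ n + 1 ∧ Fintype.card X ^ 3 ≤ n + 1 :=
    ⟨5 * Fintype.card X + Fintype.card X ^ 3, by omega, by omega⟩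
  let S := {g : tableGroup X // ∃ m ≤ n, ∃ b c : PrefixBasis X (Fin m), g.1 = elt b c}
  have hS : Finite S := by
    refine Finite.of_surjective
      (α := Σ m : Fin (n + 1), PrefixBasis X (Fin m) × PrefixBasis X (Fin m))
      (fun p => ⟨⟨elt p.2.1 p.2.2, isTableMap_elt _ _⟩, p.1, Nat.lt_succ_iff.1 p.1.2, _, _, rfl⟩) ?_
    rintro ⟨⟨g, hg⟩, m, hm, b, c, h⟩
    exact ⟨⟨⟨m, Nat.lt_succ_iff.2 hm⟩, b, c⟩, Subtype.ext (Subtype.ext h.symm)⟩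
  let R : Set (FreeGroup S) := Set.range fun p : {p : S × S × S // p.1.1 * p.2.1.1 = p.2.2.1} =>
    FreeGroup.of p.1.1 * FreeGroup.of p.1.2.1 * (FreeGroup.of p.1.2.2)⁻¹
  have hSmem : ∀ (ι : Type) [Fintype ι], Fintype.card ι ≤ n → ∀ b c : PrefixBasis X ι,
      ∃ m ≤ n, ∃ b' c' : PrefixBasis X (Fin m), elt b c = elt b' c' := fun ι _ hι b c =>
    ⟨_, hι, b.reindex (Fintype.equivFin ι).symm, c.reindex (Fintype.equivFin ι).symm,
      (elt_reindex _ _ _).symm⟩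
  let gen : ∀ (ι : Type) [Fintype ι], Fintype.card ι ≤ n → PrefixBasis X ι → PrefixBasis X ι → S :=
    fun ι _ hι b c => ⟨⟨elt b c, isTableMap_elt b c⟩, hSmem ι hι b c⟩
  let f : Equiv.Perm (ℕ → X) → PresentedGroup R := fun g =>
    if hg : ∃ h : IsTableMap g, ∃ m ≤ n, ∃ b c : PrefixBasis X (Fin m), g = elt b c
    then PresentedGroup.of ⟨⟨g, hg.1⟩, hg.2⟩ else 1
  have hf : ∀ (ι : Type) [Fintype ι] (hι : Fintype.card ι ≤ n) (b c : PrefixBasis X ι),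
      f (elt b c) = PresentedGroup.of (gen ι hι b c) := fun ι _ hι b c =>
    dif_pos ⟨isTableMap_elt b c, hSmem ι hι b c⟩
  have hcoh : Coherent X f n := by
    intro ι _ hι b c e
    rw [hf ι hι, hf ι hι, hf ι hι, ← mul_inv_eq_one]
    exact PresentedGroup.one_of_mem ⟨⟨(gen ι hι c e, gen ι hι b c, gen ι hι b e),
      Subtype.ext (elt_mul_elt b c e)⟩, rfl⟩
  obtain ⟨F, hF⟩ := hcoh.exists_monoidHom hn hn'
  let φ : PresentedGroup R →* tableGroup X := PresentedGroup.toGroup (f := Subtype.val) <| by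
    rintro _ ⟨⟨⟨g, h, k⟩, hp⟩, rfl⟩
    simpa [mul_inv_eq_one] using hp
  have h1 : F.comp φ = MonoidHom.id _ := by
    refine PresentedGroup.ext ?_
    rintro ⟨⟨g, hg⟩, m, hm, b, c, h⟩
    dsimp only at h
    subst h
    have hm' : Fintype.card (Fin m) ≤ n := by simpa using hm
    simp only [MonoidHom.comp_apply, φ, PresentedGroup.toGroup.of, MonoidHom.id_apply]
    rw [hF _ hm', hf _ hm']
  have h2 : ∀ g, φ (F g) = g := by
    let E : Subgroup (tableGroup X) := (φ.comp F).eqLocus (MonoidHom.id _)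
    rintro ⟨g, hg⟩
    obtain ⟨m, b, c, rfl⟩ := isTableMap_iff.1 hg
    have := elt_mem_of_small n hn hn' (E.map (tableGroup X).subtype) (fun ι _ hι b c => by
      refine ⟨⟨elt b c, isTableMap_elt b c⟩, ?_, rfl⟩
      change φ (F _) = _
      rw [hF _ hι, hf _ hι]
      exact PresentedGroup.toGroup.of _) _ b c
    obtain ⟨g, hgE, h⟩ := this
    obtain rfl : g = ⟨elt b c, hg⟩ := Subtype.ext h
    exact hgE
  let e : PresentedGroup R ≃* tableGroup X :=
    { φ with
      invFun := F
      left_inv := DFunLike.congr_fun h1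
      right_inv := h2 }
  have hR : Finite R := Set.finite_range _
  exact Group.IsFinitelyPresented.equiv e

/-- A table map acts on all sufficiently small cones by prefix replacement. -/
theorem exists_forall_length_le {X : Type} [Fintype X] [Nontrivial X] (g : tableGroup X) :
    ∃ N, ∀ v : List X, N ≤ v.length → ∃ u, ∀ w, g.1 (appendInf v w) = appendInf u w := by
  obtain ⟨g, hg⟩ := g
  obtain ⟨m, b, c, rfl⟩ := isTableMap_iff.1 hg
  refine ⟨m, fun v hv => ?_⟩
  obtain ⟨w, hw⟩ := exists_isPrefix v
  obtain ⟨i, hi⟩ := b.exists_isPrefix w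
  have := PrefixBasis.length_le_card _ b i
  rw [Fintype.card_fin] at this
  obtain ⟨t, rfl⟩ := hi.prefix_of_length_le hw (this.trans hv)
  exact ⟨c i ++ t, fun w => by simp [appendInf_append]⟩

namespace PrefixBasis

variable {X : Type} {ι κ : Type}

/-- The action of permutations of the words of a code. -/
noncomputable def permHom [Finite ι] (b : PrefixBasis X ι) : Equiv.Perm ι →* tableGroup X where
  toFun π := ⟨elt b (b.reindex π), isTableMap_elt _ _⟩
  map_one' := Subtype.ext (elt_self b)
  map_mul' π σ := Subtype.ext <| by
    change elt b (b.reindex (π * σ)) = elt b (b.reindex π) * elt b (b.reindex σ)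
    rw [← elt_reindex b (b.reindex π) σ, elt_mul_elt]
    rfl

theorem coe_permHom [Finite ι] (b : PrefixBasis X ι) (π : Equiv.Perm ι) :
    (b.permHom π : Equiv.Perm (ℕ → X)) = elt b (b.reindex π) := rfl

@[simp]
theorem permHom_appendInf [Finite ι] (b : PrefixBasis X ι) (π : Equiv.Perm ι) (i : ι)
    (w : ℕ → X) : (b.permHom π).1 (appendInf (b i) w) = appendInf (b (π i)) w := by
  simp [coe_permHom]

theorem permHom_injective [Nonempty X] [Finite ι] (b : PrefixBasis X ι) : Injective b.permHom := by
  refine (injective_iff_map_eq_one _).2 fun π hπ => Equiv.ext fun i => ?_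
  have h := permHom_appendInf b π i fun _ => Classical.arbitrary X
  rw [hπ] at h
  replace h : appendInf (b i) (fun _ => Classical.arbitrary X) = appendInf (b (π i)) _ := h
  exact b.eq_of_isPrefix (isPrefix_appendInf (b (π i)) _) (h ▸ isPrefix_appendInf (b i) _)

theorem permHom_prod [Finite ι] [Finite κ] (b : PrefixBasis X ι) (t : PrefixBasis X κ)
    (π : Equiv.Perm ι) :
    (b.prod t).permHom (Equiv.prodCongrLeft fun _ => π) = b.permHom π :=
  Subtype.ext <| by
    rw [coe_permHom, coe_permHom, ← elt_prod b (b.reindex π) t]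
    rfl

theorem sign_prodCongrLeft_const [Fintype ι] [DecidableEq ι] [Fintype κ] [DecidableEq κ]
    (π : Equiv.Perm ι) : Equiv.Perm.sign (Equiv.prodCongrLeft fun _ : κ => π)
      = Equiv.Perm.sign π ^ Fintype.card κ := by
  rw [Equiv.Perm.sign_prodCongrLeft, Finset.prod_const, Finset.card_univ]

theorem conj_permHom [Finite ι] (b c : PrefixBasis X ι) (g : tableGroup X) (hg : g.1 = elt b c)
    (π : Equiv.Perm ι) : g * b.permHom π * g⁻¹ = c.permHom π :=
  Subtype.ext <| by
    rw [Subgroup.coe_mul, Subgroup.coe_mul, Subgroup.coe_inv, coe_permHom, coe_permHom, hg,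
      elt_inv, mul_assoc, elt_mul_elt, ← elt_reindex b c π, elt_mul_elt]

/-- The permutation of cones given by a transposition depends only on the words involved. -/
theorem permHom_swap_eq [Finite ι] [Finite κ] [DecidableEq ι] [DecidableEq κ]
    (b : PrefixBasis X ι) (c : PrefixBasis X κ) {i j : ι} {k l : κ} (hi : b i = c k)
    (hj : b j = c l) : b.permHom (Equiv.swap i j) = c.permHom (Equiv.swap k l) := by
  refine Subtype.ext (Equiv.ext fun w => ?_)
  obtain ⟨m, hm⟩ := b.exists_isPrefix w
  obtain ⟨n, hn⟩ := c.exists_isPrefix w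
  by_cases h : m = i
  · subst h
    obtain ⟨w, rfl⟩ := isPrefix_iff_exists.1 hm
    conv_rhs => rw [hi]
    simp [hj]
  by_cases h' : m = j
  · subst h'
    obtain ⟨w, rfl⟩ := isPrefix_iff_exists.1 hm
    conv_rhs => rw [hj]
    simp [hi]
  have h1 : n ≠ k := fun e => h (b.eq_of_isPrefix hm (by rw [hi, ← e]; exact hn))
  have h2 : n ≠ l := fun e => h' (b.eq_of_isPrefix hm (by rw [hj, ← e]; exact hn))
  have e1 : (b.permHom (Equiv.swap i j)).1 w = w := by
    obtain ⟨w, rfl⟩ := isPrefix_iff_exists.1 hm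
    rw [permHom_appendInf, Equiv.swap_apply_of_ne_of_ne h h']
  have e2 : (c.permHom (Equiv.swap k l)).1 w = w := by
    obtain ⟨w, rfl⟩ := isPrefix_iff_exists.1 hn
    rw [permHom_appendInf, Equiv.swap_apply_of_ne_of_ne h1 h2]
  rw [e1, e2]

theorem apply_eq_nil [Nontrivial X] [Subsingleton ι] (b : PrefixBasis X ι) (i : ι) : b i = [] :=
  List.prefix_nil.1 <| prefix_of_forall_isPrefix fun w _ => by
    obtain ⟨j, hj⟩ := b.exists_isPrefix w
    rwa [Subsingleton.elim i j]

/-- The table group is generated by permutations of the words of codes. -/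
theorem eq_top_of_permHom_mem [Fintype X] [Nontrivial X] (G : Subgroup (tableGroup X))
    (hG : ∀ (ι : Type) [Fintype ι] (b : PrefixBasis X ι) (π : Equiv.Perm ι), b.permHom π ∈ G) :
    G = ⊤ := by
  classical
  have key : ∀ (ι : Type) [Fintype ι] (b c : PrefixBasis X ι),
      (⟨elt b c, isTableMap_elt b c⟩ : tableGroup X) ∈ G := by
    intro ι _ b c
    refine card_induction (X := X) (P := fun ι _ => ∀ b c : PrefixBasis X ι,
      (⟨elt b c, isTableMap_elt b c⟩ : tableGroup X) ∈ G) (fun ι _ h b c => ?_)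
      (fun ι _ _ hι ih b c => ?_) ι b b c
    · have : Subsingleton ι := Fintype.card_le_one_iff_subsingleton.1 h.le
      obtain rfl : b = c := by ext1 i; rw [apply_eq_nil, apply_eq_nil]
      convert G.one_mem
      exact Subtype.ext (elt_self b)
    · obtain ⟨a, ha⟩ := b.exists_caret
      obtain ⟨a', ha'⟩ := c.exists_caret
      obtain ⟨e, he⟩ := exists_equiv_comp_eq rfl ha.injective ha'.injective
      have hc : (c.reindex e).IsCaret a := IsCaret.reindex e (by simpa [he] using ha')
      obtain ⟨b₀, c₀, h⟩ := ha.exists_elt_eq hc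
      have h1 := ih _ b₀ (card_caretEquiv ha.injective) b₀ c₀
      have h2 := G.mul_mem (G.inv_mem (hG ι c e)) h1
      convert h2 using 1
      refine Subtype.ext ?_
      change elt b c = (elt c (c.reindex e))⁻¹ * elt b₀ c₀
      rw [elt_inv, ← h, elt_mul_elt]
  refine (Subgroup.eq_top_iff' G).2 ?_
  rintro ⟨g, hg⟩
  obtain ⟨m, b, c, rfl⟩ := isTableMap_iff.1 hg
  exact key _ b c

end PrefixBasis

open PrefixBasis

/-- The subgroup generated by the even permutations of the words of codes. -/
def evenGroup (X : Type) : Subgroup (tableGroup X) :=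
  Subgroup.closure {g | ∃ (ι : Type) (_ : Fintype ι) (_ : DecidableEq ι) (b : PrefixBasis X ι)
    (π : Equiv.Perm ι), Equiv.Perm.sign π = 1 ∧ b.permHom π = g}

section EvenGroup

variable {X : Type} {ι κ : Type} [Fintype ι] [DecidableEq ι] [Fintype κ] [DecidableEq κ]

theorem permHom_mem_evenGroup (b : PrefixBasis X ι) {π : Equiv.Perm ι}
    (h : Equiv.Perm.sign π = 1) : b.permHom π ∈ evenGroup X :=
  Subgroup.subset_closure ⟨ι, _, _, b, π, h, rfl⟩

theorem mk_permHom_eq_of_sign_eq (b : PrefixBasis X ι) {π σ : Equiv.Perm ι}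
    (h : Equiv.Perm.sign π = Equiv.Perm.sign σ) :
    (b.permHom π : tableGroup X ⧸ evenGroup X) = b.permHom σ := by
  rw [QuotientGroup.eq, ← map_inv, ← map_mul]
  exact permHom_mem_evenGroup _ (by simp [h])

/-- Odd permutations of the words of two codes with two words in common are congruent. -/
theorem mk_permHom_eq_of_common [Nonempty X] (b : PrefixBasis X ι) (c : PrefixBasis X κ)
    {i j : ι} {k l : κ} (hij : i ≠ j) (hi : b i = c k) (hj : b j = c l) {π : Equiv.Perm ι}
    {σ : Equiv.Perm κ} (hπ : Equiv.Perm.sign π = -1) (hσ : Equiv.Perm.sign σ = -1) :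
    (b.permHom π : tableGroup X ⧸ evenGroup X) = c.permHom σ := by
  have hkl : k ≠ l := by
    rintro rfl
    exact hij (b.injective (hi.trans hj.symm))
  rw [mk_permHom_eq_of_sign_eq b (hπ.trans (Equiv.Perm.sign_swap hij).symm),
    permHom_swap_eq b c hi hj]
  exact mk_permHom_eq_of_sign_eq c ((Equiv.Perm.sign_swap hkl).trans hσ.symm)

variable [Fintype X] [Nontrivial X]

instance : (evenGroup X).Normal := by
  classical
  refine Subgroup.Normal.mk fun n hn g => ?_
  refine (Subgroup.closure_le (K := (evenGroup X).comap (MulAut.conj g).toMonoidHom)).2 ?_ hn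
  rintro _ ⟨ι, _, _, b, π, hπ, rfl⟩
  obtain ⟨N, hN⟩ := exists_forall_length_le g
  let b' := b.prod (level X N)
  choose c hc using fun p : ι × (Fin N → X) => hN (b' p) (by simp [b'])
  have := conj_permHom b' (b'.map g c hc) g (elt_map _ _ _ _).symm (Equiv.prodCongrLeft fun _ => π)
  rw [permHom_prod] at this
  change g * b.permHom π * g⁻¹ ∈ evenGroup X
  rw [this]
  exact permHom_mem_evenGroup _ (by rw [sign_prodCongrLeft_const, hπ, one_pow])

theorem evenGroup_le_commutator : evenGroup X ≤ commutator (tableGroup X) := by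
  classical
  refine (Subgroup.closure_le _).2 ?_
  rintro _ ⟨ι, _, _, b, π, hπ, rfl⟩
  have hX := Fintype.one_lt_card (α := X)
  have hι : Nonempty ι := ⟨(b.exists_isPrefix fun _ => Classical.arbitrary X).choose⟩
  have hcard : 5 ≤ Nat.card (ι × (Fin 3 → X)) := by
    rw [Nat.card_eq_fintype_card, Fintype.card_prod]
    have h1 := Fintype.card_pos (α := ι)
    have h2 : 2 ^ 3 ≤ Fintype.card X ^ 3 := Nat.pow_le_pow_left hX 3
    simp only [Fintype.card_pi, Finset.prod_const, Finset.card_univ, Fintype.card_fin]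
    nlinarith
  rw [SetLike.mem_coe, ← permHom_prod b (level X 3)]
  have h : Equiv.prodCongrLeft (fun _ : Fin 3 → X => π) ∈ commutator (Equiv.Perm _) := by
    rw [alternatingGroup.commutator_perm_eq hcard, Equiv.Perm.mem_alternatingGroup,
      sign_prodCongrLeft_const, hπ, one_pow]
  have h' := Subgroup.mem_map_of_mem (b.prod (level X 3)).permHom h
  rw [commutator_def, Subgroup.map_commutator] at h'
  exact Subgroup.commutator_mono le_top le_top h'

end EvenGroup

theorem three_le_card_prod_level {X ι : Type} [Fintype X] [Nontrivial X] [Fintype ι]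
    (hι : Nonempty ι) {n : ℕ} (hn : 2 ≤ n) :
    3 ≤ Fintype.card (ι × (Fin n → X)) := by
  have hX := Fintype.one_lt_card (α := X)
  have h1 := Fintype.card_pos (α := ι)
  have h2 : 2 ^ 2 ≤ Fintype.card X ^ n :=
    (Nat.pow_le_pow_left hX 2).trans (Nat.pow_le_pow_right (by omega) hn)
  simp only [Fintype.card_prod, Fintype.card_pi, Finset.prod_const, Finset.card_univ,
    Fintype.card_fin]
  nlinarith

theorem nonempty_index {X ι : Type} [Nonempty X] (b : PrefixBasis X ι) : Nonempty ι :=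
  ⟨(b.exists_isPrefix fun _ => Classical.arbitrary X).choose⟩

section Congruence

variable {X : Type} {ι κ : Type} [Fintype ι] [DecidableEq ι] [Fintype κ] [DecidableEq κ]

theorem exists_ne_ne (h : 3 ≤ Fintype.card ι) (i : ι) : ∃ j k, j ≠ i ∧ k ≠ i ∧ j ≠ k := by
  have h2 : 1 < Fintype.card {j // j ≠ i} := by
    rw [Fintype.card_subtype_compl, Fintype.card_subtype_eq]
    omega
  obtain ⟨⟨j, hj⟩, ⟨k, hk⟩, hjk⟩ := Fintype.exists_pair_of_one_lt_card h2
  exact ⟨j, k, hj, hk, fun h => hjk (Subtype.ext h)⟩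

theorem mk_permHom_eq_of_forall_ne [Nonempty X] (b : PrefixBasis X ι) (c : PrefixBasis X κ)
    (hι : 3 ≤ Fintype.card ι) (i : ι) (hc : ∀ j ≠ i, ∃ k, c k = b j) {π : Equiv.Perm ι}
    {σ : Equiv.Perm κ} (hπ : Equiv.Perm.sign π = -1) (hσ : Equiv.Perm.sign σ = -1) :
    (b.permHom π : tableGroup X ⧸ evenGroup X) = c.permHom σ := by
  obtain ⟨j, k, hj, hk, hjk⟩ := exists_ne_ne hι i
  obtain ⟨l, hl⟩ := hc j hj
  obtain ⟨m, hm⟩ := hc k hk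
  exact mk_permHom_eq_of_common b c hjk hl.symm hm.symm hπ hσ

variable [Fintype X] [Nontrivial X]

theorem mk_permHom_eq_of_prefix (b : PrefixBasis X ι) (c : PrefixBasis X κ)
    (hι : 3 ≤ Fintype.card ι) (hκ : 3 ≤ Fintype.card κ) {i : ι} {k : κ} (hik : b i <+: c k)
    {π : Equiv.Perm ι} {σ : Equiv.Perm κ} (hπ : Equiv.Perm.sign π = -1)
    (hσ : Equiv.Perm.sign σ = -1) :
    (b.permHom π : tableGroup X ⧸ evenGroup X) = c.permHom σ := by
  classical
  have hX := Fintype.one_lt_card (α := X)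
  obtain ⟨s, hs⟩ := hik
  obtain ⟨κ₁, _, b₁, h1, h2, k₁, hk₁⟩ := b.exists_expand_along i s
  obtain ⟨κ₂, _, b₂, h3, h4, h5⟩ := b₁.exists_expand k₁
  obtain ⟨κ₃, _, c₃, h6, h7, h8⟩ := c.exists_expand k
  have hκ₁ : 3 ≤ Fintype.card κ₁ := by rw [h1]; exact hι.trans (Nat.le_add_right _ _)
  have odd : ∀ (l : Type) [Fintype l], 3 ≤ Fintype.card l →
      ∃ ρ : Equiv.Perm l, Equiv.Perm.sign ρ = -1 := by
    intro l _ hl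
    obtain ⟨x, y, hxy⟩ := Fintype.exists_pair_of_one_lt_card (α := l) (by omega)
    exact ⟨_, Equiv.Perm.sign_swap hxy⟩
  obtain ⟨π₁, hπ₁⟩ := odd κ₁ hκ₁
  obtain ⟨π₂, hπ₂⟩ := odd κ₂ (by omega)
  obtain ⟨π₃, hπ₃⟩ := odd κ₃ (by omega)
  obtain ⟨x, y, hxy⟩ := exists_pair_ne X
  obtain ⟨l, hl⟩ := h5 x
  obtain ⟨m, hm⟩ := h5 y
  obtain ⟨l', hl'⟩ := h8 x
  obtain ⟨m', hm'⟩ := h8 y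
  have hlm : l ≠ m := by
    rintro rfl
    simpa [hxy] using hl.symm.trans hm
  rw [mk_permHom_eq_of_forall_ne b b₁ hι i h2 hπ hπ₁,
    mk_permHom_eq_of_forall_ne b₁ b₂ hκ₁ k₁ h4 hπ₁ hπ₂,
    mk_permHom_eq_of_forall_ne c c₃ hκ k h7 hσ hπ₃,
    mk_permHom_eq_of_common b₂ c₃ hlm (hl.trans (by rw [hl', hk₁, hs]))
      (hm.trans (by rw [hm', hk₁, hs])) hπ₂ hπ₃]

/-- All odd permutations of the words of codes with at least three words are congruent modulo the
even ones. -/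
theorem mk_permHom_eq (b : PrefixBasis X ι) (c : PrefixBasis X κ)
    (hι : 3 ≤ Fintype.card ι) (hκ : 3 ≤ Fintype.card κ)
    {π : Equiv.Perm ι} {σ : Equiv.Perm κ} (hπ : Equiv.Perm.sign π = -1)
    (hσ : Equiv.Perm.sign σ = -1) :
    (b.permHom π : tableGroup X ⧸ evenGroup X) = c.permHom σ := by
  obtain ⟨i, hi⟩ := b.exists_isPrefix fun _ => Classical.arbitrary X
  obtain ⟨k, hk⟩ := c.exists_isPrefix fun _ => Classical.arbitrary X
  rcases hi.comparable hk with h | h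
  · exact mk_permHom_eq_of_prefix b c hι hκ h hπ hσ
  · exact (mk_permHom_eq_of_prefix c b hκ hι h hσ hπ).symm

theorem mk_eq_one_or (c : PrefixBasis X κ) (hκ : 3 ≤ Fintype.card κ) {σ : Equiv.Perm κ}
    (hσ : Equiv.Perm.sign σ = -1) (g : tableGroup X) :
    (g : tableGroup X ⧸ evenGroup X) = 1 ∨ (g : tableGroup X ⧸ evenGroup X) = c.permHom σ := by
  classical
  set t : tableGroup X ⧸ evenGroup X := QuotientGroup.mk (c.permHom σ) with ht
  have htt : t * t = 1 := by
    rw [ht, ← QuotientGroup.mk_mul, ← map_mul, QuotientGroup.eq_one_iff]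
    exact permHom_mem_evenGroup _ (by simp [hσ])
  have htop : (Subgroup.zpowers t).comap (QuotientGroup.mk' (evenGroup X)) = ⊤ := by
    refine eq_top_of_permHom_mem _ fun ι _ b π => ?_
    rw [← permHom_prod b (level X 2), Subgroup.mem_comap, QuotientGroup.mk'_apply]
    rcases Int.units_eq_one_or (Equiv.Perm.sign (Equiv.prodCongrLeft fun _ : Fin 2 → X => π))
      with h | h
    · rw [(QuotientGroup.eq_one_iff _).2 (permHom_mem_evenGroup _ h)]
      exact Subgroup.one_mem _
    · rw [mk_permHom_eq _ c (three_le_card_prod_level (nonempty_index b) le_rfl) hκ h hσ]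
      exact Subgroup.mem_zpowers _
  have hg : g ∈ (Subgroup.zpowers t).comap (QuotientGroup.mk' (evenGroup X)) :=
    htop ▸ Subgroup.mem_top g
  obtain ⟨n, hn⟩ := Subgroup.mem_zpowers_iff.1 (Subgroup.mem_comap.1 hg)
  rw [QuotientGroup.mk'_apply] at hn
  rw [← hn]
  obtain ⟨k, rfl | rfl⟩ := n.even_or_odd'
  · left
    rw [zpow_mul, zpow_two, htt, one_zpow]
  · right
    rw [zpow_add, zpow_mul, zpow_two, htt, one_zpow, one_mul, zpow_one]

theorem exists_code_odd (X : Type) [Fintype X] [Nontrivial X] :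
    ∃ (κ : Type) (_ : Fintype κ) (_ : DecidableEq κ) (_ : PrefixBasis X κ) (σ : Equiv.Perm κ),
      3 ≤ Fintype.card κ ∧ Equiv.Perm.sign σ = -1 := by
  classical
  have h := three_le_card_prod_level (X := X) (ι := Unit) inferInstance le_rfl
  obtain ⟨x, y, hxy⟩ := Fintype.exists_pair_of_one_lt_card (α := Unit × (Fin 2 → X)) (by omega)
  exact ⟨_, _, inferInstance, PrefixBasis.trivial.prod (level X 2), _, h,
    Equiv.Perm.sign_swap hxy⟩

theorem commutator_eq_evenGroup : commutator (tableGroup X) = evenGroup X := by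
  refine le_antisymm ?_ evenGroup_le_commutator
  obtain ⟨κ, _, _, c, σ, hκ, hσ⟩ := exists_code_odd X
  rw [commutator_def, Subgroup.commutator_le]
  intro g _ h _
  rw [← QuotientGroup.eq_one_iff, commutatorElement_def]
  simp only [QuotientGroup.mk_mul, QuotientGroup.mk_inv]
  rcases mk_eq_one_or c hκ hσ g with hg | hg <;> rcases mk_eq_one_or c hκ hσ h with hh | hh <;>
    simp [hg, hh]

theorem evenGroup_eq_top (hX : Even (Fintype.card X)) : evenGroup X = ⊤ := by
  classical
  obtain ⟨κ, _, _, c, σ, hκ, hσ⟩ := exists_code_odd X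
  have h : (c.permHom σ : tableGroup X ⧸ evenGroup X) = 1 := by
    rw [QuotientGroup.eq_one_iff, ← permHom_prod c (letters X)]
    exact permHom_mem_evenGroup _ (by rw [sign_prodCongrLeft_const, hσ, hX.neg_one_pow])
  refine (Subgroup.eq_top_iff' _).2 fun g => ?_
  rw [← QuotientGroup.eq_one_iff]
  exact (mk_eq_one_or c hκ hσ g).elim id fun hg => hg.trans h

end Congruence

open scoped commutatorElement

section Simplicity

variable {X : Type} {ι κ : Type} [Fintype ι] [DecidableEq ι] [Fintype κ] [DecidableEq κ]

/-- A nontrivial table map moves some cone to a disjoint one. -/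
theorem exists_cone_moved {g : tableGroup X} (hg : g ≠ 1) :
    ∃ p q : List X, ¬ p <+: q ∧ ¬ q <+: p ∧ ∀ w, g.1 (appendInf p w) = appendInf q w := by
  obtain ⟨m, b, c, hbc⟩ := isTableMap_iff.1 g.2
  obtain ⟨w, hw⟩ : ∃ w, g.1 w ≠ w := by
    by_contra! h
    exact hg (Subtype.ext (Equiv.ext h))
  obtain ⟨n, hn⟩ := ne_iff.1 hw
  obtain ⟨i, hi⟩ := b.exists_isPrefix w
  obtain ⟨w, rfl⟩ := isPrefix_iff_exists.1 hi
  rw [hbc, elt_appendInf] at hn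
  set v := List.ofFn fun k : Fin (n + 1) => w k
  have hv : IsPrefix v w := isPrefix_iff.2 (by simp [v, -List.ofFn_succ])
  obtain ⟨w, hw'⟩ := isPrefix_iff_exists.1 hv
  have hlen : v.length = n + 1 := by simp [v]
  rw [hw', ← appendInf_append, ← appendInf_append] at hn
  have key : ∀ {p q : List X} {w}, n < p.length → p <+: q → appendInf p w n = appendInf q w n := by
    rintro p _ w hp ⟨t, rfl⟩
    rw [appendInf_append, appendInf_of_lt hp, appendInf_of_lt hp]
  refine ⟨b i ++ v, c i ++ v, fun h => hn (key ?_ h).symm, fun h => hn (key ?_ h), fun w => ?_⟩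
  · rw [List.length_append]; omega
  · rw [List.length_append]; omega
  · rw [hbc, appendInf_append, elt_appendInf, appendInf_append]

theorem permHom_apply_of_not_isPrefix (b : PrefixBasis X κ) {p : List X} {π : Equiv.Perm κ}
    (h : ∀ k, π k ≠ k → p <+: b k) {w : ℕ → X} (hw : ¬ IsPrefix p w) :
    (b.permHom π).1 w = w := by
  obtain ⟨k, hk⟩ := b.exists_isPrefix w
  have hπ : π k = k := by
    by_contra hne
    exact hw (hk.mono (h k hne))
  obtain ⟨w, rfl⟩ := isPrefix_iff_exists.1 hk
  rw [permHom_appendInf, hπ]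

/-- If a cone is moved off itself, a commutator trick yields all even permutations of a code that
has four words in that cone. -/
theorem permHom_mem_of_cone_moved [Nonempty X] {K : Subgroup (tableGroup X)}
    (hK : ∀ e ∈ evenGroup X, ∀ k ∈ K, e * k * e⁻¹ ∈ K) {g : tableGroup X} (hg : g ∈ K)
    {p q : List X} (hpq : ¬ p <+: q) (hqp : ¬ q <+: p)
    (hgp : ∀ w, g.1 (appendInf p w) = appendInf q w) (b : PrefixBasis X κ)
    (s : Fin 4 ↪ κ) (hs : ∀ i, p <+: b (s i)) (hκ : 5 ≤ Fintype.card κ) {π : Equiv.Perm κ}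
    (hπ : Equiv.Perm.sign π = 1) : b.permHom π ∈ K := by
  have : Nontrivial (alternatingGroup κ) := by
    have := alternatingGroup.isSimpleGroup (α := κ) (by rwa [Nat.card_eq_fintype_card])
    infer_instance
  let f := Equiv.Perm.viaEmbeddingHom s
  have hf : ∀ (ρ : Equiv.Perm (Fin 4)) k, f ρ k ≠ k → p <+: b k := by
    intro ρ k hk
    by_contra h
    refine hk (Equiv.Perm.viaEmbedding_apply_of_notMem _ _ _ ?_)
    rintro ⟨i, rfl⟩
    exact h (hs i)
  have hsq : ∀ ρ : Equiv.Perm (Fin 4), Equiv.Perm.sign (f (ρ * ρ)) = 1 := fun ρ => by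
    rw [map_mul, map_mul, Int.units_mul_self]
  obtain ⟨ρ, τ, hρτ⟩ : ∃ ρ τ : Equiv.Perm (Fin 4), ⁅ρ * ρ, τ * τ⁆ ≠ 1 :=
    ⟨Equiv.swap 0 1 * Equiv.swap 1 2, Equiv.swap 0 1 * Equiv.swap 1 3, by decide⟩
  set h := b.permHom (f (ρ * ρ)) with hh
  set k := b.permHom (f (τ * τ)) with hk
  have hhE : h ∈ evenGroup X := permHom_mem_evenGroup b (hsq ρ)
  have hkE : k ∈ evenGroup X := permHom_mem_evenGroup b (hsq τ)
  have hcomm : (g * h⁻¹ * g⁻¹) * k = k * (g * h⁻¹ * g⁻¹) := by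
    refine Subtype.ext (Equiv.Perm.Disjoint.commute (f := (g * h⁻¹ * g⁻¹).1) (g := k.1) fun w => ?_)
    by_cases hw : IsPrefix p w
    · left
      have hw' : ¬ IsPrefix p ((g⁻¹).1 w) := by
        intro h1
        obtain ⟨u, hu⟩ := isPrefix_iff_exists.1 h1
        have h2 : w = appendInf q u := by
          rw [← hgp, ← hu]
          exact (g.1.apply_symm_apply w).symm
        exact (hw.comparable (h2 ▸ isPrefix_appendInf q u)).elim hpq hqp
      have h3 : (h⁻¹).1 ((g⁻¹).1 w) = (g⁻¹).1 w := by
        rw [hh, ← map_inv, ← map_inv]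
        exact permHom_apply_of_not_isPrefix b (hf _) hw'
      change g.1 ((h⁻¹).1 ((g⁻¹).1 w)) = w
      rw [h3]
      exact g.1.apply_symm_apply w
    · right
      exact permHom_apply_of_not_isPrefix b (hf _) hw
  have hmem : b.permHom (f ⁅ρ * ρ, τ * τ⁆) ∈ K := by
    have h1 : h * (g * h⁻¹ * g⁻¹) ∈ K := by
      have := K.mul_mem (hK h hhE g hg) (K.inv_mem hg)
      simpa only [mul_assoc] using this
    have h2 := K.mul_mem h1 (hK k hkE _ (K.inv_mem h1))
    convert h2 using 1
    rw [map_commutatorElement, map_commutatorElement, ← hh, ← hk, commutatorElement_def]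
    set z := g * h⁻¹ * g⁻¹
    calc _ = h * (k * z) * z⁻¹ * h⁻¹ * k⁻¹ := by group
      _ = _ := by rw [← hcomm]; group
  have hS : ((K.comap b.permHom).subgroupOf (alternatingGroup κ)).Normal := by
    refine Subgroup.Normal.mk fun n hn e => ?_
    rw [Subgroup.mem_subgroupOf, Subgroup.mem_comap] at hn ⊢
    have := hK _ (permHom_mem_evenGroup b (Equiv.Perm.mem_alternatingGroup.1 e.2)) _ hn
    rwa [← map_inv, ← map_mul, ← map_mul] at this
  have hsimple := alternatingGroup.isSimpleGroup (α := κ) (by rwa [Nat.card_eq_fintype_card])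
  rcases hS.eq_bot_or_eq_top with hS | hS
  · refine absurd ?_ hρτ
    have hsign : Equiv.Perm.sign (f ⁅ρ * ρ, τ * τ⁆) = 1 := by
      rw [map_commutatorElement, map_commutatorElement, hsq, commutatorElement_one_left]
    have h1 : (⟨_, Equiv.Perm.mem_alternatingGroup.2 hsign⟩ : alternatingGroup κ) ∈
        (K.comap b.permHom).subgroupOf (alternatingGroup κ) := hmem
    rw [hS, Subgroup.mem_bot] at h1
    exact (map_eq_one_iff _ (Equiv.Perm.viaEmbeddingHom_injective s)).1 (congrArg Subtype.val h1)
  · exact (hS ▸ Subgroup.mem_top _ : (⟨π, Equiv.Perm.mem_alternatingGroup.2 hπ⟩ :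
      alternatingGroup κ) ∈ (K.comap b.permHom).subgroupOf (alternatingGroup κ))

theorem permHom_mem_of_permHom_mem [Fintype X] [Nontrivial X] {K : Subgroup (tableGroup X)}
    (hK : ∀ e ∈ evenGroup X, ∀ k ∈ K, e * k * e⁻¹ ∈ K) (b c : PrefixBasis X κ)
    (hκ : 3 ≤ Fintype.card κ)
    (hb : ∀ π : Equiv.Perm κ, Equiv.Perm.sign π = 1 → b.permHom π ∈ K) {π : Equiv.Perm κ}
    (hπ : Equiv.Perm.sign π = 1) : c.permHom π ∈ K := by
  set t : tableGroup X := ⟨elt b c, isTableMap_elt b c⟩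
  rw [← conj_permHom b c t rfl]
  obtain ⟨x, y, hxy⟩ := Fintype.exists_pair_of_one_lt_card (α := κ) (by omega)
  rcases mk_eq_one_or b hκ (Equiv.Perm.sign_swap hxy) t with h | h
  · exact hK _ ((QuotientGroup.eq_one_iff _).1 h) _ (hb π hπ)
  · set ρ := Equiv.swap x y
    have h1 : t * (b.permHom ρ)⁻¹ ∈ evenGroup X := by
      rw [← QuotientGroup.eq_one_iff, QuotientGroup.mk_mul, QuotientGroup.mk_inv, h, mul_inv_cancel]
    have h2 := hK _ h1 _ (hb (ρ * π * ρ⁻¹) (by simp [hπ]))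
    convert h2 using 1
    simp only [map_mul, map_inv]
    group

variable [Fintype X] [Nontrivial X]

theorem exists_code_in_cone (p : List X) : ∃ M, ∀ (κ : Type) [Fintype κ], PrefixBasis X κ →
    M ≤ Fintype.card κ → ∃ (b : PrefixBasis X κ) (s : Fin 4 ↪ κ), ∀ i, p <+: b (s i) := by
  classical
  have hX := Fintype.one_lt_card (α := X)
  obtain ⟨κ₁, _, b₁, -, -, k₁, hk₁⟩ := PrefixBasis.trivial.exists_expand_along () p
  have hk₁ : b₁ k₁ = p := hk₁
  obtain ⟨f⟩ : Nonempty (Fin 5 ↪ (Fin 3 → X)) := by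
    refine Function.Embedding.nonempty_of_card_le ?_
    have h2 : 2 ^ 3 ≤ Fintype.card X ^ 3 := Nat.pow_le_pow_left hX 3
    simp only [Fintype.card_pi, Finset.prod_const, Finset.card_univ, Fintype.card_fin]
    omega
  let b₂ := b₁.prod (level X 3)
  refine ⟨Fintype.card (κ₁ × (Fin 3 → X)), fun κ _ c hc => ?_⟩
  obtain ⟨b, hb, -⟩ := exists_of_card_le b₂ (k₁, f 4) c hc
  have : ∀ i : Fin 4, ∃ k, b k = b₂ (k₁, f i.castSucc) := fun i => hb _ fun h =>
    Fin.castSucc_ne_last i (f.injective (Prod.ext_iff.1 h).2)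
  choose s hs using this
  refine ⟨b, ⟨s, fun i j hij => ?_⟩, fun i => ?_⟩
  · have h := b₂.injective ((hs i).symm.trans ((congrArg b.word hij).trans (hs j)))
    exact Fin.castSucc_injective _ (f.injective (Prod.ext_iff.1 h).2)
  · change p <+: b (s i)
    rw [hs, PrefixBasis.prod_apply, hk₁]
    exact List.prefix_append _ _

theorem evenGroup_le {K : Subgroup (tableGroup X)} (hne : K ≠ ⊥)
    (hK : ∀ e ∈ evenGroup X, ∀ k ∈ K, e * k * e⁻¹ ∈ K) : evenGroup X ≤ K := by
  classical
  obtain ⟨⟨g, hg⟩, hg1⟩ := Subgroup.ne_bot_iff_exists_ne_one.1 hne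
  replace hg1 : g ≠ 1 := fun h => hg1 (Subtype.ext h)
  obtain ⟨p, q, hpq, hqp, hgp⟩ := exists_cone_moved hg1
  obtain ⟨M, hM⟩ := exists_code_in_cone p
  refine (Subgroup.closure_le _).2 ?_
  rintro _ ⟨ι, _, _, c, π, hπ, rfl⟩
  have hX := Fintype.one_lt_card (α := X)
  have hcard : M + 5 ≤ Fintype.card (ι × (Fin (M + 5) → X)) := by
    have h1 := @Fintype.card_pos ι _ (nonempty_index c)
    have h2 := Nat.lt_pow_self hX (n := M + 5)
    simp only [Fintype.card_prod, Fintype.card_pi, Finset.prod_const, Finset.card_univ,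
      Fintype.card_fin]
    nlinarith
  obtain ⟨b, s, hs⟩ := hM _ (c.prod (level X (M + 5))) (by omega)
  rw [SetLike.mem_coe, ← permHom_prod c (level X (M + 5))]
  refine permHom_mem_of_permHom_mem hK b _ (by omega) (fun σ hσ => ?_)
    (by rw [sign_prodCongrLeft_const, hπ, one_pow])
  exact permHom_mem_of_cone_moved hK hg hpq hqp hgp b s hs (by omega) hσ

end Simplicity

section NormalSubgroups

variable {X : Type} [Fintype X] [Nontrivial X]

instance isSimpleGroup_evenGroup : IsSimpleGroup (evenGroup X) where
  exists_pair_ne := by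
    classical
    have h := three_le_card_prod_level (X := X) (ι := Unit) inferInstance le_rfl
    obtain ⟨i⟩ : Nonempty (Unit × (Fin 2 → X)) := inferInstance
    obtain ⟨j, k, hj, hk, hjk⟩ := exists_ne_ne h i
    let b := PrefixBasis.trivial.prod (level X 2)
    refine ⟨⟨b.permHom (Equiv.swap i j * Equiv.swap i k), permHom_mem_evenGroup _ ?_⟩, 1,
      fun h => ?_⟩
    · simp [Equiv.Perm.sign_swap hj.symm, Equiv.Perm.sign_swap hk.symm]
    · have h1 := (map_eq_one_iff _ b.permHom_injective).1 (congrArg Subtype.val h)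
      have h2 := DFunLike.congr_fun h1 i
      rw [Equiv.Perm.mul_apply, Equiv.swap_apply_left,
        Equiv.swap_apply_of_ne_of_ne hk hjk.symm] at h2
      exact hk h2
  eq_bot_or_eq_top_of_normal N hN := by
    refine or_iff_not_imp_left.2 fun hne => ?_
    have h := evenGroup_le (K := N.map (evenGroup X).subtype)
      (fun h => hne ((Subgroup.map_eq_bot_iff_of_injective _ Subtype.val_injective).1 h)) (by
        rintro e he _ ⟨k, hk, rfl⟩
        exact ⟨⟨e, he⟩ * k * ⟨e, he⟩⁻¹, hN.conj_mem k hk _, rfl⟩)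
    refine (Subgroup.eq_top_iff' N).2 fun x => ?_
    obtain ⟨y, hy, hyx⟩ := h x.2
    rwa [← Subtype.ext hyx]

theorem eq_evenGroup_of_normal {N : Subgroup (tableGroup X)} (hN : N.Normal) (hbot : N ≠ ⊥)
    (htop : N ≠ ⊤) : N = evenGroup X := by
  have hle := evenGroup_le hbot fun e _ k hk => hN.conj_mem k hk e
  refine le_antisymm (fun g hg => ?_) hle
  by_contra hgE
  refine htop ((Subgroup.eq_top_iff' N).2 fun h => ?_)
  obtain ⟨κ, _, _, c, σ, hκ, hσ⟩ := exists_code_odd X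
  have h1 := (mk_eq_one_or c hκ hσ g).resolve_left fun h => hgE ((QuotientGroup.eq_one_iff _).1 h)
  rcases mk_eq_one_or c hκ hσ h with h2 | h2
  · exact hle ((QuotientGroup.eq_one_iff _).1 h2)
  · simpa using N.mul_mem hg (hle (QuotientGroup.eq.1 (h1.trans h2.symm)))

theorem index_evenGroup_of_exists_notMem (h : ∃ g, g ∉ evenGroup X) : (evenGroup X).index = 2 := by
  obtain ⟨κ, _, _, c, σ, hκ, hσ⟩ := exists_code_odd X
  obtain ⟨g, hg⟩ := h
  have hc : (c.permHom σ : tableGroup X ⧸ evenGroup X) ≠ 1 := fun h =>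
    hg <| (QuotientGroup.eq_one_iff _).1 <| (mk_eq_one_or c hκ hσ g).elim id fun hg => hg.trans h
  have hcc : (c.permHom σ : tableGroup X ⧸ evenGroup X) * c.permHom σ = 1 := by
    rw [← QuotientGroup.mk_mul, ← map_mul, QuotientGroup.eq_one_iff]
    exact permHom_mem_evenGroup _ (by simp [hσ])
  refine Subgroup.index_eq_two_iff.2 ⟨c.permHom σ, fun h => ?_⟩
  rw [← QuotientGroup.eq_one_iff, ← QuotientGroup.eq_one_iff, QuotientGroup.mk_mul]
  rcases mk_eq_one_or c hκ hσ h with hh | hh <;> simp [hh, hc, hcc]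

end NormalSubgroups

section OrderSign

variable {ι κ L : Type*} [Fintype ι] [Fintype κ] [LinearOrder L]

theorem prod_lt_eq_of_symm {M : Type*} [CommMonoid M] {f g : ι → L} (hf : Injective f)
    (hg : Injective g) {t : ι → ι → M} (ht : ∀ i j, t i j = t j i) :
    ∏ i, ∏ j, (if f i < f j then t i j else 1) = ∏ i, ∏ j, if g i < g j then t i j else 1 := by
  have h : ∀ u v : ι → L, ∏ i, ∏ j, (if u i < u j then t i j else 1)
      = (∏ i, ∏ j, if u i < u j ∧ v i < v j then t i j else 1)
        * ∏ i, ∏ j, if u i < u j ∧ ¬ v i < v j then t i j else 1 := by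
    intro u v
    simp only [← Finset.prod_mul_distrib]
    refine Finset.prod_congr rfl fun i _ => Finset.prod_congr rfl fun j _ => ?_
    by_cases h1 : u i < u j <;> by_cases h2 : v i < v j <;> simp [h1, h2]
  rw [h f g, h g f]
  congr 1
  · simp only [and_comm]
  · rw [Finset.prod_comm]
    refine Finset.prod_congr rfl fun i _ => Finset.prod_congr rfl fun j _ => ?_
    rw [ht]
    refine if_congr ?_ rfl rfl
    rcases eq_or_ne i j with rfl | hij
    · simp
    · have h1 := hf.ne hij
      have h2 := hg.ne hij
      grind

/-- The sign of the permutation that turns the order of the values of `f` into that of the values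
of `g`. -/
def orderSign (f g : ι → L) : ℤˣ :=
  ∏ i, ∏ j, if f i < f j then (if g i < g j then 1 else -1) else 1

theorem orderSign_mul {f g h : ι → L} (hf : Injective f) (hg : Injective g) (hh : Injective h) :
    orderSign f g * orderSign g h = orderSign f h := by
  have h1 : orderSign g h = ∏ i, ∏ j, if f i < f j then
      ((if g i < g j then 1 else -1) * if h i < h j then 1 else -1 : ℤˣ) else 1 := by
    rw [← prod_lt_eq_of_symm hg hf]
    · refine Finset.prod_congr rfl fun i _ => Finset.prod_congr rfl fun j _ => ?_
      split_ifs <;> rfl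
    · intro i j
      rcases eq_or_ne i j with rfl | hij
      · rfl
      · rcases (hg.ne hij).lt_or_gt with h1 | h1 <;> rcases (hh.ne hij).lt_or_gt with h2 | h2 <;>
          simp [h1, h2, h1.asymm, h2.asymm]
  rw [h1, orderSign, orderSign]
  simp only [← Finset.prod_mul_distrib]
  refine Finset.prod_congr rfl fun i _ => Finset.prod_congr rfl fun j _ => ?_
  split_ifs <;> rfl

theorem orderSign_comp (f g : ι → L) (e : κ ≃ ι) : orderSign (f ∘ e) (g ∘ e) = orderSign f g := by
  rw [orderSign, orderSign, ← e.prod_comp]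
  exact Finset.prod_congr rfl fun i _ => e.prod_comp fun j =>
    if f (e i) < f j then (if g (e i) < g j then 1 else -1) else (1 : ℤˣ)

/-- Splitting one value into an odd number of consecutive ones does not change the sign. -/
theorem orderSign_sum {f g : ι ⊕ Unit → L} {f' g' : ι ⊕ κ → L} (hκ : Odd (Fintype.card κ))
    (hf : ∀ i j, f' (.inl i) < f' (.inl j) ↔ f (.inl i) < f (.inl j))
    (hg : ∀ i j, g' (.inl i) < g' (.inl j) ↔ g (.inl i) < g (.inl j))
    (hf₁ : ∀ i x, f' (.inl i) < f' (.inr x) ↔ f (.inl i) < f (.inr ()))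
    (hg₁ : ∀ i x, g' (.inl i) < g' (.inr x) ↔ g (.inl i) < g (.inr ()))
    (hf₂ : ∀ i x, f' (.inr x) < f' (.inl i) ↔ f (.inr ()) < f (.inl i))
    (hg₂ : ∀ i x, g' (.inr x) < g' (.inl i) ↔ g (.inr ()) < g (.inl i))
    (hfg : ∀ x y, f' (.inr x) < f' (.inr y) → g' (.inr x) < g' (.inr y)) :
    orderSign f' g' = orderSign f g := by
  have hpow : ∀ a : ℤˣ, a ^ Fintype.card κ = a := fun a => by
    obtain ⟨k, hk⟩ := hκ
    rw [hk, pow_succ, pow_mul, Int.units_sq, one_pow, one_mul]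
  have h4 : ∀ x y, (if f' (.inr x) < f' (.inr y) then
      (if g' (.inr x) < g' (.inr y) then 1 else -1) else 1 : ℤˣ) = 1 := by
    intro x y
    split_ifs with h h'
    · rfl
    · exact absurd (hfg x y h) h'
    · rfl
  simp only [orderSign, Fintype.prod_sum_type, hf, hg, hf₁, hg₁, hf₂, hg₂, h4,
    Finset.prod_mul_distrib, Finset.prod_const, Finset.card_univ, hpow,
    Finset.univ_unique, Finset.prod_singleton, lt_self_iff_false, if_false, one_pow]

theorem orderSign_perm {n : ℕ} {f : Fin n → L} (hf : StrictMono f) (σ : Equiv.Perm (Fin n)) :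
    orderSign f (f ∘ σ) = Equiv.Perm.sign σ := by
  rw [Equiv.Perm.sign_eq_prod_prod_Ioi, orderSign]
  refine Finset.prod_congr rfl fun i _ => ?_
  simp only [comp_apply, hf.lt_iff_lt]
  rw [← Finset.prod_filter]
  congr 1
  ext j
  simp

end OrderSign

section Words

variable {X : Type*} [LinearOrder X]

theorem append_lt_append {u v : List X} (huv : ¬ u <+: v) (hvu : ¬ v <+: u) (h : u < v)
    (s t : List X) : u ++ s < v ++ t := by
  induction u generalizing v with
  | nil => exact absurd List.nil_prefix huv
  | cons x u ih =>
    cases v with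
    | nil => exact absurd List.nil_prefix hvu
    | cons y v =>
      rw [List.cons_append, List.cons_append]
      rcases List.cons_lt_cons_iff.1 h with h' | ⟨rfl, h'⟩
      · exact List.cons_lt_cons_iff.2 (.inl h')
      · rw [List.prefix_cons_inj] at huv hvu
        exact List.cons_lt_cons_iff.2 (.inr ⟨rfl, ih huv hvu h'⟩)

theorem append_lt_append_iff {u v : List X} (huv : ¬ u <+: v) (hvu : ¬ v <+: u) (s t : List X) :
    u ++ s < v ++ t ↔ u < v := by
  refine ⟨fun h => ?_, fun h => append_lt_append huv hvu h s t⟩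
  rcases lt_trichotomy u v with h' | rfl | h'
  · exact h'
  · exact absurd (List.prefix_refl u) huv
  · exact absurd h (append_lt_append hvu huv h' t s).asymm

theorem append_singleton_lt_iff (u : List X) (x y : X) : u ++ [x] < u ++ [y] ↔ x < y := by
  induction u with
  | nil => simp [List.cons_lt_cons_iff]
  | cons z u ih => simpa [List.cons_lt_cons_iff] using ih

end Words

section Sign

variable {X : Type} [Fintype X] [Nontrivial X] [LinearOrder X] {ι κ : Type} [Fintype ι] [Fintype κ]

theorem orderSign_expand (hX : Odd (Fintype.card X)) (b c : PrefixBasis X (ι ⊕ Unit)) :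
    orderSign b.expand c.expand = orderSign b c := by
  have h1 : ∀ (b : PrefixBasis X (ι ⊕ Unit)) i (x : X),
      b (.inl i) < b (.inr ()) ++ [x] ↔ b (.inl i) < b (.inr ()) := fun b i x => by
    simpa using append_lt_append_iff (mt b.eq_of_prefix Sum.inl_ne_inr)
      (mt b.eq_of_prefix Sum.inr_ne_inl) [] [x]
  have h2 : ∀ (b : PrefixBasis X (ι ⊕ Unit)) i (x : X),
      b (.inr ()) ++ [x] < b (.inl i) ↔ b (.inr ()) < b (.inl i) := fun b i x => by
    simpa using append_lt_append_iff (mt b.eq_of_prefix Sum.inr_ne_inl)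
      (mt b.eq_of_prefix Sum.inl_ne_inr) [x] []
  apply orderSign_sum hX <;> simp [h1, h2, append_singleton_lt_iff]

/-- For alphabets of odd size, the sign of a table depends only on the map it describes. -/
theorem orderSign_eq_of_elt_eq (hX : Odd (Fintype.card X)) (ι κ : Type) [Fintype ι] [Fintype κ]
    {b c : PrefixBasis X ι} {b' c' : PrefixBasis X κ} (h : elt b c = elt b' c') :
    orderSign b c = orderSign b' c' := by
  classical
  induction hn : Fintype.card ι + Fintype.card κ using Nat.strong_induction_on
    generalizing ι κ with
  | _ n ih =>
    subst hn
    wlog hcard : Fintype.card κ ≤ Fintype.card ι generalizing ι κ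
    · exact (this κ ι h.symm (fun m hm ι κ _ _ b c b' c' h h' => ih m (by omega) ι κ h h')
        (by omega)).symm
    by_cases hcar : ∃ a, b.IsCaret a ∧ c.IsCaret a
    · obtain ⟨a, hb, hc⟩ := hcar
      obtain ⟨b₀, hb₀⟩ := hb.exists_contract
      obtain ⟨c₀, hc₀⟩ := hc.exists_contract
      have h1 : elt b₀ c₀ = elt b' c' := by rw [← elt_expand, hb₀, hc₀, elt_reindex, h]
      have h2 := card_caretEquiv hb.injective
      have h3 := Fintype.one_lt_card (α := X)
      rw [← ih _ (by omega) _ κ h1 rfl, ← orderSign_expand hX, hb₀, hc₀]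
      exact (orderSign_comp b.word c.word (caretEquiv a hb.injective)).symm
    · push Not at hcar
      obtain ⟨e, rfl, rfl⟩ := exists_reindex_eq_of_not_caret h hcar hcard
      exact (orderSign_comp b.word c.word e).symm

theorem exists_signHom (hX : Odd (Fintype.card X)) : ∃ s : tableGroup X →* ℤˣ,
    ∀ (ι : Type) [Fintype ι] (b c : PrefixBasis X ι),
      s ⟨elt b c, isTableMap_elt b c⟩ = orderSign b c := by
  choose m b c h using fun g : tableGroup X => isTableMap_iff.1 g.2
  have key : ∀ (ι : Type) [Fintype ι] (b' c' : PrefixBasis X ι) (g : tableGroup X),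
      g.1 = elt b' c' → orderSign (b g) (c g) = orderSign b' c' := fun ι _ b' c' g hg =>
    orderSign_eq_of_elt_eq hX _ _ ((h g).symm.trans hg)
  refine ⟨MonoidHom.mk' (fun g => orderSign (b g) (c g)) fun g k => ?_,
    fun ι _ b' c' => key ι b' c' _ rfl⟩
  obtain ⟨n, p, q, r, hk, hg⟩ := exists_elt_elt k.2 g.2
  rw [key _ q r g hg, key _ p q k hk, key _ p r (g * k)
    (by rw [Subgroup.coe_mul, hg, hk, elt_mul_elt]), mul_comm]
  exact (orderSign_mul p.injective q.injective r.injective).symm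

end Sign

theorem exists_notMem_evenGroup {X : Type} [Fintype X] [Nontrivial X]
    (hX : Odd (Fintype.card X)) : ∃ g, g ∉ evenGroup X := by
  classical
  let _ : LinearOrder X := LinearOrder.lift' (Fintype.equivFin X) (Fintype.equivFin X).injective
  obtain ⟨s, hs⟩ := exists_signHom hX
  let e := Fintype.orderIsoFinOfCardEq X rfl
  let b := (letters X).reindex e.toEquiv
  have hb : StrictMono b.word := fun i j hij =>
    (append_singleton_lt_iff [] _ _).2 (e.strictMono hij)
  obtain ⟨x, y, hxy⟩ := Fintype.exists_pair_of_one_lt_card (α := Fin (Fintype.card X))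
    (by rw [Fintype.card_fin]; exact Fintype.one_lt_card)
  refine ⟨b.permHom (Equiv.swap x y), fun h => ?_⟩
  rw [← commutator_eq_evenGroup] at h
  have h1 := MonoidHom.mem_ker.1 (Abelianization.commutator_subset_ker s h)
  have h2 : s (b.permHom (Equiv.swap x y)) = -1 := by
    rw [← Equiv.Perm.sign_swap hxy, ← orderSign_perm hb]
    exact hs _ b (b.reindex (Equiv.swap x y))
  rw [h2] at h1
  exact absurd h1 (by decide)

end HigmanThompson

/-- The Higman–Thompson group `V_d`: the table maps form a group under composition,
this group is finitely presented, its commutator subgroup `V_d'` equals `V_d` for even `d`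
and has index 2 for odd `d`, and `V_d'` is simple and is the only non-trivial proper
normal subgroup of `V_d`. -/
theorem higman_thompson_group
    (d : ℕ) (hd : 1 < d) (X : Type) [Fintype X] (hX : Fintype.card X = d) :
    ∃ H : Subgroup (Equiv.Perm (ℕ → X)),
      ((H : Set (Equiv.Perm (ℕ → X))) = {τ | IsTableMap τ}) ∧
      IsFinitelyPresentedGroup H ∧
      (Even d → commutator ↥H = ⊤) ∧
      (Odd d → (commutator ↥H).index = 2) ∧
      IsSimpleGroup ↥(commutator ↥H) ∧
      (∀ N : Subgroup ↥H, N.Normal → N ≠ ⊥ → N ≠ ⊤ → N = commutator ↥H) := by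
  have : Nontrivial X := Fintype.one_lt_card_iff_nontrivial.1 (hX ▸ hd)
  subst hX
  refine ⟨HigmanThompson.tableGroup X, rfl, ?_, ?_⟩
  · obtain ⟨n, s, hs, ⟨e⟩⟩ :=
      (HigmanThompson.isFinitelyPresented_tableGroup X).exists_mulEquiv_presentedGroup
    lift s to Finset (FreeGroup (Fin n)) using hs
    exact ⟨n, s, ⟨e⟩⟩
  · rw [HigmanThompson.commutator_eq_evenGroup]
    exact ⟨HigmanThompson.evenGroup_eq_top, fun h =>
      HigmanThompson.index_evenGroup_of_exists_notMem (HigmanThompson.exists_notMem_evenGroup h),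
      inferInstance, fun N hN => HigmanThompson.eq_evenGroup_of_normal hN⟩
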